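/- arXiv:2509.10030 — 2 statements merged into one kernel-verified Lean document; each statement's English description precedes it below -/
import Mathlib

section
/- For every positive integer m, π(g_m) ≤ 18·3^m / (m·ln(18·3^m)), where π is the prime-counting function and g_m := lcm(1,…,m)·∑_{j=1}^m 1/j. -/
/-- `gNat m = lcm(1,…,m) · ∑_{j=1}^m 1/j`, computed exactly in `ℕ`
(each `j` divides the lcm, so the natural division is exact). -/
def gNat (m : ℕ) : ℕ := ∑ j ∈ Finset.Icc 1 m, ((Finset.Icc 1 m).lcm id) / j

/-! ### Kernel computations -/

def lcmStep (chk : ℕ → ℕ → Bool) (n d : ℕ) : ℕ :=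
  let d' := d * (n + 1) / Nat.gcd d (n + 1)
  bif chk (n + 1) d' then d' else 0

def lcmRun (chk : ℕ → ℕ → Bool) (k : ℕ) : ℕ → ℕ → ℕ :=
  Nat.rec (motive := fun _ => ℕ → ℕ → ℕ) (fun n d => lcmStep chk n d)
    (fun k ih n d => Nat.rec (motive := fun _ => ℕ) 0 (fun d' _ => ih (n + 2 ^ k) (d' + 1)) (ih n d)) k

theorem lcmUpto_succ' (n : ℕ) :
    Nat.lcmUpto (n + 1) = Nat.lcmUpto n * (n + 1) / Nat.gcd (Nat.lcmUpto n) (n + 1) := by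
  have : Finset.Icc 1 (n + 1) = insert (n + 1) (Finset.Icc 1 n) := by
    ext x; simp; omega
  rw [Nat.lcmUpto, this, Finset.lcm_insert]
  change Nat.lcm (n + 1) (Nat.lcmUpto n) = _
  rw [Nat.lcm_comm]; rfl

theorem lcmRun_spec (chk : ℕ → ℕ → Bool) (k : ℕ) : ∀ n, lcmRun chk k n (Nat.lcmUpto n) ≠ 0 →
    lcmRun chk k n (Nat.lcmUpto n) = Nat.lcmUpto (n + 2 ^ k) ∧
      ∀ j, n < j → j ≤ n + 2 ^ k → chk j (Nat.lcmUpto j) = true := by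
  induction k with
  | zero =>
    intro n h
    have hs : ∀ d, lcmRun chk 0 n d = bif chk (n + 1) (d * (n + 1) / Nat.gcd d (n + 1)) then
      d * (n + 1) / Nat.gcd d (n + 1) else 0 := fun d => rfl
    rw [hs] at h ⊢
    rw [← lcmUpto_succ'] at h ⊢
    cases hc : chk (n + 1) (Nat.lcmUpto (n + 1)) with
    | false => simp [hc] at h
    | true =>
      refine ⟨by simp, fun j h1 h2 => ?_⟩
      have : j = n + 1 := by simp at h2; omega
      rw [this]; exact hc
  | succ k ih =>
    intro n h
    have hs : ∀ d, lcmRun chk (k + 1) n d = Nat.rec (motive := fun _ => ℕ) 0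
      (fun d' _ => lcmRun chk k (n + 2 ^ k) (d' + 1)) (lcmRun chk k n d) := fun d => rfl
    rw [hs] at h ⊢
    by_cases h0 : lcmRun chk k n (Nat.lcmUpto n) = 0
    · rw [h0] at h; exact absurd rfl h
    · obtain ⟨h1, h2⟩ := ih n h0
      rw [h1] at h ⊢
      obtain ⟨e, he⟩ := Nat.exists_eq_succ_of_ne_zero (Nat.lcmUpto_ne_zero (n + 2 ^ k))
      rw [he] at h ⊢
      simp only [← Nat.succ_eq_add_one] at h ⊢
      rw [← he] at h ⊢
      obtain ⟨h3, h4⟩ := ih (n + 2 ^ k) h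
      refine ⟨by rw [h3]; congr 1; rw [Nat.succ_eq_add_one, pow_succ]; ring, fun j hj1 hj2 => ?_⟩
      by_cases hj : j ≤ n + 2 ^ k
      · exact h2 j hj1 hj
      · exact h4 j (by omega) (by rw [pow_succ] at hj2; omega)

def chk1 (n d : ℕ) : Bool := Nat.ble (d * 20 ^ n) (59 ^ n)
def chk2 (n d : ℕ) : Bool := Nat.ble n 199 || Nat.ble (d * n ^ 3) (15 * 3 ^ n)

set_option maxRecDepth 100000 in
theorem run1 : Nat.beq (lcmRun chk1 13 0 1) 0 = false := by decide +kernel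

set_option maxRecDepth 100000 in
theorem run2 : Nat.beq (lcmRun chk2 11 0 1) 0 = false := by decide +kernel

theorem lcmUpto_zero' : Nat.lcmUpto 0 = 1 := by simp [Nat.lcmUpto]

theorem lcm_small1 (j : ℕ) (h : j ≤ 8192) : Nat.lcmUpto j * 20 ^ j ≤ 59 ^ j := by
  rcases Nat.eq_zero_or_pos j with rfl | hj
  · simp [lcmUpto_zero']
  have h0 : lcmRun chk1 13 0 (Nat.lcmUpto 0) ≠ 0 := by
    rw [lcmUpto_zero']; exact Nat.ne_of_beq_eq_false run1
  have := (lcmRun_spec chk1 13 0 h0).2 j hj (by norm_num; exact h)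
  exact Nat.le_of_ble_eq_true this

theorem lcm_small2 (j : ℕ) (h : j ≤ 2048) (h' : 200 ≤ j) : Nat.lcmUpto j * j ^ 3 ≤ 15 * 3 ^ j := by
  have h0 : lcmRun chk2 11 0 (Nat.lcmUpto 0) ≠ 0 := by
    rw [lcmUpto_zero']; exact Nat.ne_of_beq_eq_false run2
  have := (lcmRun_spec chk2 11 0 h0).2 j (by omega) (by norm_num; exact h)
  simp only [chk2, Bool.or_eq_true] at this
  rcases this with h | h
  · have := Nat.le_of_ble_eq_true h; omega
  · exact Nat.le_of_ble_eq_true h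

def gRun (chk : ℕ → ℕ → Bool) (k : ℕ) : ℕ → ℕ → ℕ → Bool :=
  Nat.rec (motive := fun _ => ℕ → ℕ → ℕ → Bool) (fun _ _ _ => true)
    (fun _ ih n d g =>
      Nat.rec (motive := fun _ => Bool) false (fun x _ =>
        Nat.rec (motive := fun _ => Bool) false (fun y _ =>
          bif chk (n + 1) (y + 1) then ih (n + 1) (x + 1) (y + 1) else false)
          (g * ((x + 1) / d) + (x + 1) / (n + 1)))
        (d * (n + 1) / Nat.gcd d (n + 1))) k

theorem lcmUpto_dvd_succ (n : ℕ) : Nat.lcmUpto n ∣ Nat.lcmUpto (n + 1) := by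
  refine Finset.lcm_dvd fun j hj => ?_
  have : j ∈ Finset.Icc 1 (n + 1) := by simp at hj ⊢; omega
  exact Finset.dvd_lcm (f := id) this

theorem gNat_succ (n : ℕ) : gNat (n + 1) =
    gNat n * (Nat.lcmUpto (n + 1) / Nat.lcmUpto n) + Nat.lcmUpto (n + 1) / (n + 1) := by
  have h1 : ∀ m, gNat m = ∑ j ∈ Finset.Icc 1 m, Nat.lcmUpto m / j := fun m => rfl
  rw [h1, h1, Finset.sum_Icc_succ_top (by omega), Finset.sum_mul]
  congr 1
  refine Finset.sum_congr rfl fun j hj => ?_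
  have h2 : j ∣ Nat.lcmUpto n := Finset.dvd_lcm (f := id) hj
  obtain ⟨e, he⟩ := lcmUpto_dvd_succ n
  rw [he, Nat.mul_div_cancel_left _ (Nat.lcmUpto_pos n), mul_comm, Nat.mul_div_assoc _ h2, mul_comm]

theorem gRun_spec (chk : ℕ → ℕ → Bool) (k : ℕ) : ∀ n,
    gRun chk k n (Nat.lcmUpto n) (gNat n) = true →
      ∀ j, n < j → j ≤ n + k → chk j (gNat j) = true := by
  induction k with
  | zero => intro n _ j h1 h2; omega
  | succ k ih =>
    intro n h j h1 h2
    have hs : ∀ d g, gRun chk (k + 1) n d g = Nat.rec (motive := fun _ => Bool) false (fun x _ =>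
        Nat.rec (motive := fun _ => Bool) false (fun y _ =>
          bif chk (n + 1) (y + 1) then gRun chk k (n + 1) (x + 1) (y + 1) else false)
          (g * ((x + 1) / d) + (x + 1) / (n + 1)))
        (d * (n + 1) / Nat.gcd d (n + 1)) := fun d g => rfl
    rw [hs, ← lcmUpto_succ'] at h
    obtain ⟨e, he⟩ := Nat.exists_eq_succ_of_ne_zero (Nat.lcmUpto_ne_zero (n + 1))
    rw [he] at h
    simp only [← Nat.succ_eq_add_one] at h
    rw [← he, Nat.succ_eq_add_one, ← gNat_succ] at h
    rcases hg : gNat (n + 1) with _ | y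
    · rw [hg] at h; exact absurd h (by simp)
    · rw [hg] at h
      have h : (bif chk (n + 1) (y + 1) then gRun chk k (n + 1) (Nat.lcmUpto (n + 1)) (y + 1)
        else false) = true := h
      rw [← hg] at h
      cases hc : chk (n + 1) (gNat (n + 1)) with
      | false => simp [hc] at h
      | true =>
        simp only [hc, cond_true] at h
        by_cases hj : j = n + 1
        · rw [hj]; exact hc
        · exact ih (n + 1) h j (by omega) (by omega)

def tbl : List (ℕ × ℕ) := [(1, 1), (2, 3), (3, 11), (4, 25), (5, 137), (6, 147), (7, 1089),
  (8, 2283), (9, 7129), (10, 7381), (11, 83711), (12, 86021), (13, 1145993), (17, 42142223),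
  (19, 825887397), (31, 290774257297357), (32, 586061125622639)]

def chk3 (n g : ℕ) : Bool :=
  (tbl.any fun p => Nat.beq n p.1 && Nat.beq g p.2) ||
    (Nat.ble 1000000 g &&
      Nat.ble (2800 * g * n * (4170 + 1585 * n)) (18 * 3 ^ n * Nat.log2 g * 1000000))

theorem run3 : gRun chk3 207 0 1 0 = true := by decide +kernel

theorem g_small (m : ℕ) (h1 : 1 ≤ m) (h2 : m ≤ 207) : (m, gNat m) ∈ tbl ∨ (1000000 ≤ gNat m ∧
    2800 * gNat m * m * (4170 + 1585 * m) ≤ 18 * 3 ^ m * Nat.log2 (gNat m) * 1000000) := by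
  have h0 : gRun chk3 207 0 (Nat.lcmUpto 0) (gNat 0) = true := by
    rw [lcmUpto_zero', show gNat 0 = 0 by simp [gNat]]; exact run3
  have := gRun_spec chk3 207 0 h0 m (by omega) (by omega)
  simp only [chk3, Bool.or_eq_true, Bool.and_eq_true, List.any_eq_true] at this
  rcases this with ⟨p, hp, ha, hb⟩ | ⟨ha, hb⟩
  · left
    have h3 : (m, gNat m) = p := Prod.ext (Nat.eq_of_beq_eq_true ha) (Nat.eq_of_beq_eq_true hb)
    rw [h3]; exact hp
  · right
    exact ⟨Nat.le_of_ble_eq_true ha, Nat.le_of_ble_eq_true hb⟩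

/-! ### A Chebyshev-type bound -/

open ArithmeticFunction in
theorem log_fact_sum (N : ℕ) (q : ℕ) (hq : q ≤ N) :
    Real.log (q.factorial) = ∑ d ∈ Finset.Ioc 0 N, vonMangoldt d * ((q / d : ℕ) : ℝ) := by
  induction q with
  | zero => simp
  | succ q ih =>
    have h1 : ∀ d, (((q + 1) / d : ℕ) : ℝ) = ((q / d : ℕ) : ℝ) + if d ∣ q + 1 then 1 else 0 := by
      intro d; rw [Nat.succ_div]; push_cast; rfl
    simp_rw [h1, mul_add]
    rw [Finset.sum_add_distrib, ← ih (by omega), Nat.factorial_succ, Nat.cast_mul,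
      Real.log_mul (by positivity) (by positivity), add_comm]
    congr 1
    rw [← vonMangoldt_sum]
    simp_rw [mul_ite, mul_one, mul_zero]
    rw [← Finset.sum_filter]
    refine Finset.sum_congr ?_ fun _ _ => rfl
    ext d
    simp only [Nat.mem_divisors, Finset.mem_filter, Finset.mem_Ioc]
    constructor
    · rintro ⟨h, -⟩
      have := Nat.le_of_dvd (by omega) h
      have := Nat.pos_of_dvd_of_pos h (by omega)
      exact ⟨⟨by omega, by omega⟩, h⟩
    · rintro ⟨-, h⟩; exact ⟨h, by omega⟩

def fC (j : ℕ) : ℤ := (j : ℤ) - (j / 2 : ℕ) - (j / 3 : ℕ) - (j / 5 : ℕ) - (j / 7 : ℕ)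
  + (j / 10 : ℕ) + (j / 14 : ℕ) - (j / 20 : ℕ) + (j / 21 : ℕ) + (j / 30 : ℕ) - (j / 42 : ℕ)
  - (j / 420 : ℕ)

theorem fC_small : ∀ r < 420, (if r = 0 ∨ 6 ≤ r then 0 else 1) ≤ fC r := by decide +kernel

theorem fC_ge (j : ℕ) (hj : 1 ≤ j) : (if 6 ≤ j then 0 else 1) ≤ fC j := by
  have h1 : fC j = fC (j % 420) := by
    have hd := Nat.div_add_mod j 420
    generalize j / 420 = q at hd
    generalize j % 420 = r at hd ⊢
    have hk : ∀ k e : ℕ, 0 < k → 420 = k * e → j / k = e * q + r / k := by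
      intro k e hk he
      rw [← hd, he, mul_assoc, Nat.mul_add_div hk]
    simp only [fC]
    rw [hk 2 210 (by norm_num) (by norm_num), hk 3 140 (by norm_num) (by norm_num),
      hk 5 84 (by norm_num) (by norm_num), hk 7 60 (by norm_num) (by norm_num),
      hk 10 42 (by norm_num) (by norm_num), hk 14 30 (by norm_num) (by norm_num),
      hk 20 21 (by norm_num) (by norm_num), hk 21 20 (by norm_num) (by norm_num),
      hk 30 14 (by norm_num) (by norm_num), hk 42 10 (by norm_num) (by norm_num),
      hk 420 1 (by norm_num) (by norm_num), ← hd]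
    push_cast
    ring
  have h2 := fC_small (j % 420) (Nat.mod_lt _ (by norm_num))
  rw [h1]
  refine le_trans ?_ h2
  split_ifs <;> omega

open Real in
theorem psi_step (n : ℕ) : Chebyshev.psi n - Chebyshev.psi ((n / 6 : ℕ) : ℝ) ≤
    log (n.factorial) - log ((n / 2).factorial) - log ((n / 3).factorial) - log ((n / 5).factorial)
    - log ((n / 7).factorial) + log ((n / 10).factorial) + log ((n / 14).factorial)
    - log ((n / 20).factorial) + log ((n / 21).factorial) + log ((n / 30).factorial)
    - log ((n / 42).factorial) - log ((n / 420).factorial) := by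
  have hk : ∀ k, log ((n / k).factorial) =
      ∑ d ∈ Finset.Ioc 0 n, ArithmeticFunction.vonMangoldt d * ((n / d / k : ℕ) : ℝ) := by
    intro k
    rw [log_fact_sum n (n / k) (Nat.div_le_self _ _)]
    refine Finset.sum_congr rfl fun d _ => ?_
    rw [Nat.div_div_eq_div_mul, Nat.div_div_eq_div_mul, mul_comm k d]
  rw [hk 2, hk 3, hk 5, hk 7, hk 10, hk 14, hk 20, hk 21, hk 30, hk 42, hk 420,
    log_fact_sum n n le_rfl]
  simp only [← Finset.sum_sub_distrib, ← Finset.sum_add_distrib, ← mul_sub, ← mul_add]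
  have h6 : Chebyshev.psi ((n / 6 : ℕ) : ℝ) = ∑ d ∈ Finset.Ioc 0 n,
      if 6 ≤ n / d then ArithmeticFunction.vonMangoldt d else 0 := by
    rw [← Finset.sum_filter, Chebyshev.psi, Nat.floor_natCast]
    refine Finset.sum_congr ?_ fun _ _ => rfl
    ext d
    simp only [Finset.mem_Ioc, Finset.mem_filter]
    constructor
    · rintro ⟨h1, h2⟩
      rw [Nat.le_div_iff_mul_le (by norm_num)] at h2
      exact ⟨⟨h1, by omega⟩, (Nat.le_div_iff_mul_le h1).2 (by linarith)⟩
    · rintro ⟨⟨h1, h2⟩, h3⟩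
      refine ⟨h1, ?_⟩
      rw [Nat.le_div_iff_mul_le h1] at h3
      rw [Nat.le_div_iff_mul_le (by norm_num)]; linarith
  rw [h6, Chebyshev.psi, Nat.floor_natCast, ← Finset.sum_sub_distrib]
  refine Finset.sum_le_sum fun d hd => ?_
  simp only [Finset.mem_Ioc] at hd
  have h1 := fC_ge (n / d) ((Nat.one_le_div_iff hd.1).2 hd.2)
  have h2 : (((if 6 ≤ n / d then 0 else 1 : ℤ)) : ℝ) ≤ (fC (n / d) : ℝ) := by exact_mod_cast h1
  have h3 := ArithmeticFunction.vonMangoldt_nonneg (n := d)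
  have h4 := mul_le_mul_of_nonneg_left h2 h3
  have h5 : (fC (n / d) : ℝ) = ((n / d : ℕ) : ℝ) - ((n / d / 2 : ℕ) : ℝ) - ((n / d / 3 : ℕ) : ℝ)
    - ((n / d / 5 : ℕ) : ℝ) - ((n / d / 7 : ℕ) : ℝ) + ((n / d / 10 : ℕ) : ℝ)
    + ((n / d / 14 : ℕ) : ℝ) - ((n / d / 20 : ℕ) : ℝ) + ((n / d / 21 : ℕ) : ℝ)
    + ((n / d / 30 : ℕ) : ℝ) - ((n / d / 42 : ℕ) : ℝ) - ((n / d / 420 : ℕ) : ℝ) := by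
    simp only [fC]; push_cast; rfl
  rw [h5] at h4
  refine le_trans (le_of_eq ?_) h4
  split_ifs <;> simp

section
open Real

theorem mlog_mono {a b : ℝ} (ha : 1 ≤ a) (hab : a ≤ b) : a * log a - a ≤ b * log b - b := by
  have hb : 0 < b := by linarith
  have h1 : log (a / b) ≤ a / b - 1 := log_le_sub_one_of_pos (by positivity)
  rw [log_div (by linarith) (by linarith)] at h1
  have h2 : b * (log a - log b) ≤ b * (a / b - 1) := mul_le_mul_of_nonneg_left h1 hb.le
  have h3 : b * (a / b - 1) = a - b := by field_simp
  have h4 : 0 ≤ log a := log_nonneg ha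
  nlinarith

theorem log_fact_upper (q : ℕ) (hq : 1 ≤ q) :
    log (q.factorial) ≤ q * log q - q + log q + 1 := by
  induction q, hq using Nat.le_induction with
  | base => simp
  | succ q hq ih =>
    have hq0 : (0 : ℝ) < q := by exact_mod_cast hq
    rw [Nat.factorial_succ, Nat.cast_mul, log_mul (by positivity) (by positivity)]
    push_cast
    have h1 : log ((q : ℝ) / (q + 1)) ≤ q / (q + 1) - 1 := log_le_sub_one_of_pos (by positivity)
    rw [log_div (by positivity) (by positivity)] at h1
    have h2 := mul_le_mul_of_nonneg_left h1 (show (0 : ℝ) ≤ q + 1 by positivity)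
    have h3 : ((q : ℝ) + 1) * (q / (q + 1) - 1) = -1 := by field_simp; ring
    nlinarith

theorem log_fact_lower (q : ℕ) (hq : 1 ≤ q) : q * log q - q ≤ log (q.factorial) := by
  have h := Stirling.le_log_factorial_stirling (n := q) (by omega)
  have h1 : 0 ≤ log (q : ℝ) := log_natCast_nonneg q
  have h2 : 0 ≤ log (2 * π) := log_nonneg (by linarith [pi_gt_three])
  linarith

theorem upperY (n k : ℕ) (hk : 1 ≤ k) (hkn : k ≤ n) :
    log ((n / k).factorial) ≤ n / k * (log n - log k) - n / k + (log n - log k) + 1 := by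
  have hk0 : (0 : ℝ) < k := by exact_mod_cast hk
  have hn0 : (0 : ℝ) < n := by exact_mod_cast (by omega : 0 < n)
  have hq : 1 ≤ n / k := (Nat.one_le_div_iff (by omega)).2 hkn
  have hq' : (1 : ℝ) ≤ ((n / k : ℕ) : ℝ) := by exact_mod_cast hq
  have hqy : ((n / k : ℕ) : ℝ) ≤ (n : ℝ) / k := Nat.cast_div_le
  have h1 := log_fact_upper (n / k) hq
  have h2 := mlog_mono hq' hqy
  have h3 := log_le_log (by linarith) hqy
  rw [log_div hn0.ne' hk0.ne'] at h2 h3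
  linarith

theorem lowerY (n k : ℕ) (hk : 1 ≤ k) (hkn : k ≤ n) :
    n / k * (log n - log k) - n / k - (log n - log k) - k / n ≤ log ((n / k).factorial) := by
  have hk0 : (0 : ℝ) < k := by exact_mod_cast hk
  have hn0 : (0 : ℝ) < n := by exact_mod_cast (by omega : 0 < n)
  have hqy : ((n / k : ℕ) : ℝ) ≤ (n : ℝ) / k := Nat.cast_div_le
  have hy1 : (1 : ℝ) ≤ (n : ℝ) / k := by rw [le_div_iff₀ hk0]; simpa using hkn
  have hyp : (n : ℝ) / k ≤ ((n / k + 1 : ℕ) : ℝ) := by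
    rw [div_le_iff₀ hk0]
    have := Nat.lt_div_mul_add (a := n) (b := k) (by omega)
    have h : n ≤ (n / k + 1) * k := by rw [add_mul, one_mul]; exact this.le
    exact_mod_cast h
  have h1 := log_fact_lower (n / k + 1) (Nat.succ_le_succ (Nat.zero_le _))
  have h2 := mlog_mono hy1 hyp
  rw [Nat.factorial_succ, Nat.cast_mul, log_mul (by positivity) (by positivity)] at h1
  have h3 : log (((n / k + 1 : ℕ) : ℝ)) ≤ log ((n : ℝ) / k) + k / n := by
    have h5 : log (((n / k + 1 : ℕ) : ℝ)) ≤ log ((n : ℝ) / k * (1 + k / n)) := by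
      apply log_le_log (by positivity)
      have : (n : ℝ) / k * (1 + k / n) = n / k + 1 := by field_simp
      rw [this]; push_cast; linarith
    rw [log_mul (by positivity) (by positivity)] at h5
    have := log_le_sub_one_of_pos (show (0 : ℝ) < 1 + k / n by positivity)
    linarith
  rw [log_div hn0.ne' hk0.ne'] at h2 h3
  linarith

theorem log7_bounds : 1.9458 < log 7 ∧ log 7 < 1.9460 := by
  have h1 : log (2401 : ℝ) = 4 * log 7 := by
    rw [show (2401 : ℝ) = 7 ^ 4 by norm_num, log_pow]; norm_num
  have h2 : log (2400 : ℝ) = 5 * log 2 + log 3 + 2 * log 5 := by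
    rw [show (2400 : ℝ) = 2 ^ 5 * 3 * 5 ^ 2 by norm_num, log_mul (by norm_num) (by norm_num),
      log_mul (by norm_num) (by norm_num), log_pow, log_pow]; norm_num
  have h3 : log (2400 : ℝ) ≤ log 2401 := log_le_log (by norm_num) (by norm_num)
  have h4 : log (2401 / 2400 : ℝ) ≤ 2401 / 2400 - 1 := log_le_sub_one_of_pos (by norm_num)
  rw [log_div (by norm_num) (by norm_num)] at h4
  have := log_two_gt_d9
  have := log_two_lt_d9
  have := log_three_gt_d9
  have := log_three_lt_d9
  have := log_five_gt_d9
  have := log_five_lt_d9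
  constructor <;> norm_num at * <;> linarith

theorem psi_step2 (n : ℕ) (hn : 8192 ≤ n) :
    Chebyshev.psi n - Chebyshev.psi ((n / 6 : ℕ) : ℝ) ≤ 0.8888 * n + 12 * log n - 24 := by
  have h := psi_step n
  have u1 := upperY n 1 (by omega) (by omega)
  have u10 := upperY n 10 (by omega) (by omega)
  have u14 := upperY n 14 (by omega) (by omega)
  have u21 := upperY n 21 (by omega) (by omega)
  have u30 := upperY n 30 (by omega) (by omega)
  have l2 := lowerY n 2 (by omega) (by omega)
  have l3 := lowerY n 3 (by omega) (by omega)
  have l5 := lowerY n 5 (by omega) (by omega)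
  have l7 := lowerY n 7 (by omega) (by omega)
  have l20 := lowerY n 20 (by omega) (by omega)
  have l42 := lowerY n 42 (by omega) (by omega)
  have l420 := lowerY n 420 (by omega) (by omega)
  have hn' : (8192 : ℝ) ≤ n := by exact_mod_cast hn
  have hinv : (n : ℝ)⁻¹ ≤ 8192⁻¹ := by gcongr
  push_cast at *
  have e10 : log (10 : ℝ) = log 2 + log 5 := by
    rw [← log_mul (by norm_num) (by norm_num)]; norm_num
  have e14 : log (14 : ℝ) = log 2 + log 7 := by
    rw [← log_mul (by norm_num) (by norm_num)]; norm_num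
  have e21 : log (21 : ℝ) = log 3 + log 7 := by
    rw [← log_mul (by norm_num) (by norm_num)]; norm_num
  have e30 : log (30 : ℝ) = log 2 + log 3 + log 5 := by
    rw [← log_mul (by norm_num) (by norm_num), ← log_mul (by norm_num) (by norm_num)]; norm_num
  have e20 : log (20 : ℝ) = log 2 + log 2 + log 5 := by
    rw [← log_mul (by norm_num) (by norm_num), ← log_mul (by norm_num) (by norm_num)]; norm_num
  have e42 : log (42 : ℝ) = log 2 + log 3 + log 7 := by
    rw [← log_mul (by norm_num) (by norm_num), ← log_mul (by norm_num) (by norm_num)]; norm_num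
  have e420 : log (420 : ℝ) = log 2 + log 2 + log 3 + log 5 + log 7 := by
    rw [← log_mul (by norm_num) (by norm_num), ← log_mul (by norm_num) (by norm_num),
      ← log_mul (by norm_num) (by norm_num), ← log_mul (by norm_num) (by norm_num)]; norm_num
  rw [e10] at u10
  rw [e14] at u14
  rw [e21] at u21
  rw [e30] at u30
  rw [e20] at l20
  rw [e42] at l42
  rw [e420] at l420
  rw [log_one, Nat.div_one] at u1
  simp only [div_eq_mul_inv] at u1 u10 u14 u21 u30 l2 l3 l5 l7 l20 l42 l420
  have b2 := log_two_gt_d9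
  have b2' := log_two_lt_d9
  have b3 := log_three_gt_d9
  have b3' := log_three_lt_d9
  have b5 := log_five_gt_d9
  have b5' := log_five_lt_d9
  obtain ⟨b7, b7'⟩ := log7_bounds
  have hA : log 2 * (1/2 - 1/10 - 1/14 + 2/20 - 1/30 + 1/42 + 2/420)
      + log 3 * (1/3 - 1/21 - 1/30 + 1/42 + 1/420)
      + log 5 * (1/5 - 1/10 - 1/30 + 1/20 + 1/420)
      + log 7 * (1/7 - 1/14 - 1/21 + 1/42 + 1/420) ≤ 0.8888 := by
    norm_num at *; linarith
  have hAn := mul_le_mul_of_nonneg_left hA (show (0:ℝ) ≤ n by positivity)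
  set N : ℝ := (n : ℝ)
  set Li := log N
  generalize log (2 : ℝ) = a2 at *
  generalize log (3 : ℝ) = a3 at *
  generalize log (5 : ℝ) = a5 at *
  generalize log (7 : ℝ) = a7 at *
  norm_num at *
  have hc : log N - a2 + (log N - a3) = 2 * log N - a2 - a3 := by ring
  linarith

end

section
open Real

theorem c_bounds : 1.0816 < log (59 / 20) ∧ log (59 / 20) < 1.082 := by
  have h1 : log (59 / 20 : ℝ) = log 3 + log (59 / 60) := by
    rw [← log_mul (by norm_num) (by norm_num)]; norm_num
  have h2 : log (59 / 60 : ℝ) ≤ 59 / 60 - 1 := log_le_sub_one_of_pos (by norm_num)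
  have h3 : log (60 / 59 : ℝ) ≤ 60 / 59 - 1 := log_le_sub_one_of_pos (by norm_num)
  have h4 : log (60 / 59 : ℝ) = - log (59 / 60) := by rw [← log_inv]; norm_num
  have b3 := log_three_gt_d9
  have b3' := log_three_lt_d9
  rw [h1]
  constructor <;> norm_num at * <;> linarith

theorem psi_le_c (n : ℕ) : Chebyshev.psi n ≤ log (59 / 20) * n := by
  induction n using Nat.strong_induction_on with
  | _ n ih =>
  rcases le_or_gt n 8192 with hn | hn
  · rw [Chebyshev.psi_eq_log_lcmUpto]
    have h := lcm_small1 n hn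
    have h1 : (Nat.lcmUpto n : ℝ) ≤ (59 / 20) ^ n := by
      rw [div_pow, le_div_iff₀ (by positivity)]
      exact_mod_cast h
    have h2 := log_le_log (by exact_mod_cast Nat.lcmUpto_pos n) h1
    rw [log_pow] at h2
    linarith
  · have h1 := psi_step2 n hn.le
    have h2 := ih (n / 6) (by omega)
    have h3 : ((n / 6 : ℕ) : ℝ) ≤ (n : ℝ) / 6 := by simpa using Nat.cast_div_le (α := ℝ) (m := n) (n := 6)
    obtain ⟨c1, c2⟩ := c_bounds
    have hn' : (8192 : ℝ) < n := by exact_mod_cast hn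
    have h4 : log (n : ℝ) ≤ 13 * log 2 + (n / 8192 - 1) := by
      have e : log (n : ℝ) = log 8192 + log (n / 8192) := by
        rw [← log_mul (by norm_num) (by positivity)]; congr 1; field_simp
      have e2 : log (8192 : ℝ) = 13 * log 2 := by
        rw [show (8192 : ℝ) = 2 ^ 13 by norm_num, log_pow]; norm_num
      have := log_le_sub_one_of_pos (show (0 : ℝ) < n / 8192 by positivity)
      linarith
    have h5 := log_two_lt_d9
    have h6 : log (59 / 20) * ((n / 6 : ℕ) : ℝ) ≤ log (59 / 20) * (n / 6) :=
      mul_le_mul_of_nonneg_left h3 (by linarith)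
    have h7 : 1.0816 * (n : ℝ) ≤ log (59 / 20) * n :=
      mul_le_mul_of_nonneg_right c1.le (by positivity)
    norm_num at c1 c2 h1 h5 h7 ⊢
    linarith

theorem theta_le_c (t : ℝ) (ht : 0 ≤ t) : Chebyshev.theta t ≤ 1.082 * t := by
  have h1 := (Chebyshev.theta_le_psi t).trans_eq (Chebyshev.psi_eq_psi_coe_floor t)
  have h2 := psi_le_c ⌊t⌋₊
  have h3 := Nat.floor_le ht
  obtain ⟨c1, c2⟩ := c_bounds
  have h4 : log (59 / 20) * (⌊t⌋₊ : ℝ) ≤ 1.082 * t :=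
    mul_le_mul c2.le h3 (by positivity) (by norm_num)
  linarith

theorem theta_le_big (u : ℕ) (hu : 8192 ≤ u) :
    Chebyshev.theta u ≤ (0.8888 + 1.082 / 6) * u + 12 * log u - 24 := by
  have h1 := Chebyshev.theta_le_psi u
  have h2 := psi_le_c (u / 6)
  have h3 : ((u / 6 : ℕ) : ℝ) ≤ (u : ℝ) / 6 := by simpa using Nat.cast_div_le (α := ℝ) (m := u) (n := 6)
  obtain ⟨c1, c2⟩ := c_bounds
  have h4 : log (59 / 20) * ((u / 6 : ℕ) : ℝ) ≤ 1.082 * (u / 6) :=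
    mul_le_mul c2.le h3 (by positivity) (by norm_num)
  have h5 := psi_step2 u hu
  linarith

theorem int_bound (u k : ℝ) (hk : 2 < k) (hu : exp k ≤ u) :
    ∫ t in (2 : ℝ)..u, 1 / log t ^ 2 ≤ exp k / log 2 ^ 2 + k / (k - 2) * (u / log u ^ 2) := by
  have he : 2 < exp k := by linarith [add_one_le_exp k]
  have hi : ∀ a b : ℝ, 1 < a → 1 < b →
      IntervalIntegrable (fun x ↦ 1 / log x ^ 2) MeasureTheory.volume a b :=
    fun a b ha hb => Chebyshev.intervalIntegrable_one_div_log_sq ha hb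
  rw [← intervalIntegral.integral_add_adjacent_intervals (b := exp k)
    (hi _ _ (by norm_num) (by linarith)) (hi _ _ (by linarith) (by linarith))]
  have hl2 : 0 < log 2 := log_pos (by norm_num)
  refine add_le_add ?_ ?_
  · calc ∫ t in (2 : ℝ)..exp k, 1 / log t ^ 2 ≤ ∫ t in (2 : ℝ)..exp k, 1 / log 2 ^ 2 := by
          refine intervalIntegral.integral_mono_on he.le (hi _ _ (by norm_num) (by linarith))
            (by simp) fun x hx => ?_
          have := log_le_log (by norm_num) hx.1
          gcongr
      _ = (exp k - 2) * (1 / log 2 ^ 2) := by simp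
      _ ≤ exp k * (1 / log 2 ^ 2) := by gcongr; linarith
      _ = _ := by ring
  · have hlog : ∀ t ∈ Set.uIcc (exp k) u, 0 < t ∧ k ≤ log t := by
      intro t ht
      rw [Set.uIcc_of_le hu] at ht
      have : 0 < t := by linarith [ht.1]
      exact ⟨this, (le_log_iff_exp_le this).2 ht.1⟩
    have hd : ∀ t ∈ Set.uIcc (exp k) u, HasDerivAt (fun t => k / (k - 2) * (t / log t ^ 2))
        (k / (k - 2) * (1 / log t ^ 2 - 2 / log t ^ 3)) t := by
      intro t ht
      obtain ⟨h0, h1⟩ := hlog t ht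
      have hl : log t ≠ 0 := by linarith
      have := ((hasDerivAt_id t).div ((hasDerivAt_log h0.ne').pow 2) (pow_ne_zero 2 hl)).const_mul (k / (k - 2))
      refine HasDerivAt.congr_deriv this ?_
      simp only [Pi.pow_apply, id]
      push_cast
      norm_num
      left
      field_simp
    have hc : ContinuousOn (fun t => k / (k - 2) * (1 / log t ^ 2 - 2 / log t ^ 3))
        (Set.uIcc (exp k) u) := by
      intro t ht
      obtain ⟨h0, h1⟩ := hlog t ht
      have hl : log t ≠ 0 := by linarith
      have h2 : log t ^ 2 ≠ 0 := pow_ne_zero _ hl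
      have h3 : log t ^ 3 ≠ 0 := pow_ne_zero _ hl
      have h0' := h0.ne'
      apply ContinuousAt.continuousWithinAt
      fun_prop (disch := assumption)
    have hF := intervalIntegral.integral_eq_sub_of_hasDerivAt hd hc.intervalIntegrable
    have hm : ∫ t in exp k..u, 1 / log t ^ 2 ≤
        ∫ t in exp k..u, k / (k - 2) * (1 / log t ^ 2 - 2 / log t ^ 3) := by
      refine intervalIntegral.integral_mono_on hu (hi _ _ (by linarith) (by linarith))
        hc.intervalIntegrable fun t ht => ?_
      obtain ⟨h0, h1⟩ := hlog t (by rw [Set.uIcc_of_le hu]; exact ht)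
      have hl : 0 < log t := by linarith
      have hk2 : 0 < k - 2 := by linarith
      rw [show k / (k - 2) * (1 / log t ^ 2 - 2 / log t ^ 3) =
        1 / log t ^ 2 * ((k * (log t - 2)) / ((k - 2) * log t)) by field_simp]
      refine le_mul_of_one_le_right (by positivity) ?_
      rw [one_le_div (by positivity)]
      nlinarith
    rw [hF] at hm
    have hk2 : 0 < k - 2 := by linarith
    have : 0 ≤ k / (k - 2) * (exp k / log (exp k) ^ 2) := by positivity
    linarith

theorem pi_bound (u : ℕ) (k : ℝ) (hk : 2 < k) (hu : exp k ≤ u) :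
    (Nat.primeCounting u : ℝ) ≤ Chebyshev.theta u / log u +
      1.082 * (exp k / log 2 ^ 2 + k / (k - 2) * (u / log u ^ 2)) := by
  have he : 2 < exp k := by linarith [add_one_le_exp k]
  have hu2 : (2 : ℝ) ≤ u := by linarith
  have h := Chebyshev.primeCounting_eq_theta_div_log_add_integral hu2
  rw [Nat.floor_natCast] at h
  rw [h]
  have h1 := int_bound u k hk hu
  have h2 : ∫ t in (2 : ℝ)..u, Chebyshev.theta t / (t * log t ^ 2) ≤
      ∫ t in (2 : ℝ)..u, 1.082 * (1 / log t ^ 2) := by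
    refine intervalIntegral.integral_mono_on hu2 ?_ ?_ fun t ht => ?_
    · rw [intervalIntegrable_iff_integrableOn_Icc_of_le hu2]
      exact Chebyshev.integrableOn_theta_div_id_mul_log_sq u
    · exact (Chebyshev.intervalIntegrable_one_div_log_sq (by norm_num) (by linarith)).const_mul _
    · have ht0 : 0 < t := by linarith [ht.1]
      have hl : 0 < log t := log_pos (by linarith [ht.1])
      have := theta_le_c t ht0.le
      rw [div_le_iff₀ (by positivity)]
      calc Chebyshev.theta t ≤ 1.082 * t := this
        _ = _ := by field_simp
  rw [intervalIntegral.integral_const_mul] at h2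
  have h3 := mul_le_mul_of_nonneg_left h1 (show (0 : ℝ) ≤ 1.082 by norm_num)
  linarith

end

section
open Real

theorem log_rhs (m : ℕ) : log (18 * 3 ^ m) = log 2 + (m + 2) * log 3 := by
  rw [show (18 : ℝ) * 3 ^ m = 2 * 3 ^ (m + 2) by ring, log_mul (by norm_num) (by positivity),
    log_pow]
  push_cast; ring

theorem log_rhs_pos (m : ℕ) : 0 < log (18 * 3 ^ m) := by
  rw [log_rhs]
  have := log_two_gt_d9
  have := log_three_gt_d9
  have : 0 < log (3 : ℝ) := by norm_num at *; linarith
  have : 0 < log (2 : ℝ) := by norm_num at *; linarith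
  positivity

theorem log_rhs_le (m : ℕ) : log (18 * 3 ^ m) ≤ 2.8904 + 1.0987 * m := by
  rw [log_rhs]
  have h1 := log_two_lt_d9
  have h2 := log_three_lt_d9
  have h3 : log 3 * (m : ℝ) ≤ 1.0987 * m :=
    mul_le_mul_of_nonneg_right (by norm_num at *; linarith) (by positivity)
  norm_num at *
  linarith

/-- Reduction to a numerical bound. -/
theorem finish (m : ℕ) (hm : 1 ≤ m) (B : ℝ) (hB : (Nat.primeCounting (gNat m) : ℝ) ≤ B)
    (h : B * (m * (2.8904 + 1.0987 * m)) ≤ 18 * 3 ^ m) :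
    (Nat.primeCounting (gNat m) : ℝ) ≤ 18 * 3 ^ m / ((m : ℝ) * log (18 * 3 ^ m)) := by
  have hm0 : (0 : ℝ) < m := by exact_mod_cast hm
  have hl := log_rhs_pos m
  have hB0 : 0 ≤ B := le_trans (by positivity) hB
  rw [le_div_iff₀ (by positivity)]
  refine le_trans ?_ h
  gcongr
  exact log_rhs_le m

theorem pi_le_self (n : ℕ) : Nat.primeCounting n ≤ n := by
  have := Nat.primeCounting_add_le (a := 1) (k := 1) (by norm_num) (by norm_num) (n - 1)
  rcases n with _ | n
  · simp
  · have h1 : Nat.primeCounting 1 = 0 := by decide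
    simp [h1] at this
    rw [add_comm]
    omega

theorem pi_le_28 (u : ℕ) (hu : 1000000 ≤ u) : (Nat.primeCounting u : ℝ) ≤ 2.8 * u / log u := by
  have hu' : (1000000 : ℝ) ≤ u := by exact_mod_cast hu
  have h := Chebyshev.pi_le_log4_mul_div (x := u) (by linarith)
  rw [Nat.floor_natCast] at h
  have hs : 1000 ≤ √(u : ℝ) := by
    rw [show (1000 : ℝ) = √(1000 ^ 2) by rw [sqrt_sq (by norm_num)]]
    exact sqrt_le_sqrt (by norm_num; exact hu)
  set s := √(u : ℝ) with hsdef
  have hus : (u : ℝ) = s ^ 2 := (sq_sqrt (by positivity)).symm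
  have hls : log (u : ℝ) = 2 * log s := by rw [hus, log_pow]; norm_num
  have h1000 : log (1000 : ℝ) = 3 * log 2 + 3 * log 5 := by
    rw [show (1000 : ℝ) = 2 ^ 3 * 5 ^ 3 by norm_num, log_mul (by norm_num) (by norm_num), log_pow,
      log_pow]; norm_num
  have h2 : log s ≤ log 1000 + (s / 1000 - 1) := by
    have e : log s = log 1000 + log (s / 1000) := by
      rw [← log_mul (by norm_num) (by positivity)]; congr 1; field_simp
    have := log_le_sub_one_of_pos (show (0 : ℝ) < s / 1000 by positivity)
    linarith
  have b2 := log_two_lt_d9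
  have b5 := log_five_lt_d9
  have h3 : log s ≤ 0.0136 * s := by
    rw [h1000] at h2; norm_num at *; linarith
  have h4 : log (4 : ℝ) = 2 * log 2 := by
    rw [show (4 : ℝ) = 2 ^ 2 by norm_num, log_pow]; norm_num
  have hlp : 0 < log s := log_pos (by linarith)
  refine h.trans ?_
  rw [hls, h4, hus, div_add' _ _ _ hlp.ne', div_le_div_iff₀ hlp (by positivity)]
  have h5 : 2 * log 2 * s ^ 2 + s * log s ≤ 1.4 * s ^ 2 := by
    have h6 : s * log s ≤ s * (0.0136 * s) := mul_le_mul_of_nonneg_left h3 (by positivity)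
    have h7 : log 2 * s ^ 2 ≤ 0.69315 * s ^ 2 :=
      mul_le_mul_of_nonneg_right (by norm_num at *; linarith) (by positivity)
    nlinarith
  nlinarith

theorem case_mid (m : ℕ) (hm : 1 ≤ m) (h1 : 1000000 ≤ gNat m)
    (h2 : 2800 * gNat m * m * (4170 + 1585 * m) ≤ 18 * 3 ^ m * Nat.log2 (gNat m) * 1000000) :
    (Nat.primeCounting (gNat m) : ℝ) ≤ 18 * 3 ^ m / ((m : ℝ) * log (18 * 3 ^ m)) := by
  have hp := pi_le_28 _ h1
  have hlg : (2 : ℝ) ^ Nat.log2 (gNat m) ≤ gNat m := by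
    exact_mod_cast Nat.log2_self_le (by omega : gNat m ≠ 0)
  have hl := log_le_log (by positivity) hlg
  rw [log_pow] at hl
  have h2' : (2800 : ℝ) * gNat m * m * (4170 + 1585 * m) ≤
    18 * 3 ^ m * Nat.log2 (gNat m) * 1000000 := by exact_mod_cast h2
  have hm0 : (0 : ℝ) < m := by exact_mod_cast hm
  have hr := log_rhs_pos m
  have hu : (1000000 : ℝ) ≤ gNat m := by exact_mod_cast h1
  generalize (Nat.log2 (gNat m) : ℝ) = lg at *
  generalize (gNat m : ℝ) = u at *
  have hup : 0 < log u := log_pos (by linarith)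
  have b2 := log_two_gt_d9
  have b2p : 0 < log (2 : ℝ) := log_pos (by norm_num)
  have b3 := log_three_lt_d9
  have h32 : log 3 ≤ 1.585 * log 2 := by norm_num at *; linarith
  have hR : log (18 * 3 ^ m) ≤ log 2 * (4.17 + 1.585 * m) := by
    rw [log_rhs]
    nlinarith
  rw [le_div_iff₀ (by positivity)]
  calc _ ≤ 2.8 * u / log u * (m * (log 2 * (4.17 + 1.585 * m))) := by gcongr
    _ = (2800 * u * m * (4170 + 1585 * m)) / 1000000 * (log 2 / log u) := by
      field_simp; ring
    _ ≤ (18 * 3 ^ m * lg * 1000000) / 1000000 * (log 2 / log u) := by gcongr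
    _ = 18 * 3 ^ m * (lg * log 2 / log u) := by ring
    _ ≤ 18 * 3 ^ m * 1 := by
      gcongr
      rw [div_le_one hup]; exact hl
    _ = _ := by ring

theorem pow_cmp (m : ℕ) (hm : 1200 ≤ m) : m ^ 3 * 59 ^ m ≤ 15 * 60 ^ m := by
  induction m, hm using Nat.le_induction with
  | base => decide +kernel
  | succ m hm ih =>
    have h : (m + 1) ^ 3 * 59 ≤ 60 * m ^ 3 := by nlinarith [sq_nonneg (m : ℤ)]
    calc (m + 1) ^ 3 * 59 ^ (m + 1) = (m + 1) ^ 3 * 59 * 59 ^ m := by ring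
      _ ≤ 60 * m ^ 3 * 59 ^ m := by gcongr
      _ = 60 * (m ^ 3 * 59 ^ m) := by ring
      _ ≤ 60 * (15 * 60 ^ m) := by gcongr
      _ = _ := by ring

theorem lcm_cube (m : ℕ) (hm : 200 ≤ m) : (Nat.lcmUpto m : ℝ) * m ^ 3 ≤ 15 * 3 ^ m := by
  rcases le_or_gt m 2048 with h | h
  · exact_mod_cast lcm_small2 m h hm
  · have h1 := psi_le_c m
    rw [Chebyshev.psi_eq_log_lcmUpto, mul_comm, ← log_pow] at h1
    have h2 := (log_le_log_iff (by exact_mod_cast Nat.lcmUpto_pos m) (by positivity)).1 h1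
    have h3 : (m : ℝ) ^ 3 * 59 ^ m ≤ 15 * 60 ^ m := by exact_mod_cast pow_cmp m (by omega)
    calc (Nat.lcmUpto m : ℝ) * m ^ 3 ≤ ((59 : ℝ) / 20) ^ m * (m : ℝ) ^ 3 := by gcongr
      _ = (m : ℝ) ^ 3 * 59 ^ m / 20 ^ m := by rw [div_pow]; ring
      _ ≤ (15 : ℝ) * 60 ^ m / 20 ^ m := by gcongr
      _ = 15 * 3 ^ m := by rw [mul_div_assoc, ← div_pow]; norm_num

theorem gNat_le (m : ℕ) : gNat m ≤ m * Nat.lcmUpto m := by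
  calc gNat m ≤ ∑ j ∈ Finset.Icc 1 m, Nat.lcmUpto m :=
        Finset.sum_le_sum fun j _ => Nat.div_le_self _ _
    _ = _ := by simp

theorem case_big (m : ℕ) (hm : 200 ≤ m) :
    (Nat.primeCounting (gNat m) : ℝ) ≤ 18 * 3 ^ m / ((m : ℝ) * log (18 * 3 ^ m)) := by
  have h1 : (Nat.primeCounting (gNat m) : ℝ) ≤ m * Nat.lcmUpto m := by
    exact_mod_cast (pi_le_self _).trans (gNat_le m)
  refine finish m (by omega) _ h1 ?_
  have h2 := lcm_cube m hm
  have hm' : (200 : ℝ) ≤ m := by exact_mod_cast hm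
  calc (m : ℝ) * Nat.lcmUpto m * (m * (2.8904 + 1.0987 * m))
      ≤ (m : ℝ) * Nat.lcmUpto m * (m * (1.2 * m)) := by gcongr; norm_num; linarith
    _ = 1.2 * (Nat.lcmUpto m * m ^ 3) := by ring
    _ ≤ 1.2 * (15 * 3 ^ m) := by gcongr
    _ = _ := by ring

theorem log_lower (u i j : ℕ) (hi : 0 < i) (hu : 0 < u) (h : 2 ^ j ≤ u ^ i) :
    (j : ℝ) / i * 0.69314 ≤ log u := by
  have h' : (2 : ℝ) ^ j ≤ (u : ℝ) ^ i := by exact_mod_cast h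
  have h1 := log_le_log (by positivity) h'
  rw [log_pow, log_pow] at h1
  have hi' : (0 : ℝ) < i := by exact_mod_cast hi
  have b2 := log_two_gt_d9
  rw [div_mul_eq_mul_div, div_le_iff₀ hi']
  have : (j : ℝ) * 0.69314 ≤ j * log 2 :=
    mul_le_mul_of_nonneg_left (by norm_num at *; linarith) (by positivity)
  linarith

theorem pi_num (u k : ℕ) (c L : ℝ) (hk : 3 ≤ k) (hu : (2.7183 : ℝ) ^ k ≤ u) (hc : 0 ≤ c)
    (ht : Chebyshev.theta u ≤ c * u) (hL : 0 < L) (hLu : L ≤ log u) :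
    (Nat.primeCounting u : ℝ) ≤
      c * u / L + 1.082 * (2.7183 ^ k / 0.48 + k / (k - 2) * (u / L ^ 2)) := by
  have hk' : (3 : ℝ) ≤ k := by exact_mod_cast hk
  have he : exp k ≤ 2.7183 ^ k := by
    rw [← exp_one_pow]
    have := exp_one_lt_d9
    exact pow_le_pow_left₀ (by positivity) (by norm_num at *; linarith) _
  have h := pi_bound u k (by linarith) (he.trans hu)
  have b2 := log_two_gt_d9
  have h48 : 0.48 ≤ log 2 ^ 2 := by norm_num at *; nlinarith
  have hk2 : (0 : ℝ) < k - 2 := by linarith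
  refine h.trans ?_
  have hlog : 0 < log (u : ℝ) := by linarith
  gcongr

theorem theta_le_sharp (u : ℕ) (hu : 10000000 ≤ u) (hu2 : u ≤ 2 ^ 64) :
    Chebyshev.theta u ≤ 1.0692 * u := by
  have h := theta_le_big u (by omega)
  have hu' : (10000000 : ℝ) ≤ u := by exact_mod_cast hu
  have hu2' : (u : ℝ) ≤ 2 ^ 64 := by exact_mod_cast hu2
  have h1 := log_le_log (by linarith) hu2'
  rw [log_pow] at h1
  have b2 := log_two_lt_d9
  norm_num at h h1 b2 ⊢
  linarith

theorem case_tbl (m : ℕ) (h : (m, gNat m) ∈ tbl) :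
    (Nat.primeCounting (gNat m) : ℝ) ≤ 18 * 3 ^ m / ((m : ℝ) * log (18 * 3 ^ m)) := by
  have sieve : ∀ n, Nat.primeCounting (210 + n) ≤ 46 + 48 * (n / 210 + 1) := by
    intro n
    have h := Nat.primeCounting_add_le (a := 210) (k := 210) (by norm_num) (by norm_num) n
    have h1 : Nat.primeCounting 210 = 46 := by decide +kernel
    have h2 : Nat.totient 210 = 48 := by decide +kernel
    rwa [h1, h2] at h
  have key : ∀ (m g B : ℕ), 1 ≤ m → gNat m = g → Nat.primeCounting g ≤ B →
      B * (m * (28904 + 10987 * m)) ≤ 180000 * 3 ^ m →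
      (Nat.primeCounting (gNat m) : ℝ) ≤ 18 * 3 ^ m / ((m : ℝ) * log (18 * 3 ^ m)) := by
    intro m g B hm hg hB hn
    refine finish m hm B (by rw [hg]; exact_mod_cast hB) ?_
    have : (B : ℝ) * (m * (28904 + 10987 * m)) ≤ 180000 * 3 ^ m := by exact_mod_cast hn
    norm_num
    linarith
  simp only [tbl, List.mem_cons, Prod.mk.injEq, List.not_mem_nil, or_false] at h
  rcases h with ⟨rfl, h⟩ | ⟨rfl, h⟩ | ⟨rfl, h⟩ | ⟨rfl, h⟩ | ⟨rfl, h⟩ | ⟨rfl, h⟩ | ⟨rfl, h⟩ |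
    ⟨rfl, h⟩ | ⟨rfl, h⟩ | ⟨rfl, h⟩ | ⟨rfl, h⟩ | ⟨rfl, h⟩ | ⟨rfl, h⟩ | ⟨rfl, h⟩ | ⟨rfl, h⟩ |
    ⟨rfl, h⟩ | ⟨rfl, h⟩
  · exact key 1 _ 0 (by norm_num) h (by decide +kernel) (by norm_num)
  · exact key 2 _ 2 (by norm_num) h (by decide +kernel) (by norm_num)
  · exact key 3 _ 5 (by norm_num) h (by decide +kernel) (by norm_num)
  · exact key 4 _ 9 (by norm_num) h (by decide +kernel) (by norm_num)
  · exact key 5 _ 33 (by norm_num) h (by decide +kernel) (by norm_num)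
  · exact key 6 _ 34 (by norm_num) h (by decide +kernel) (by norm_num)
  · exact key 7 _ _ (by norm_num) h (sieve 879) (by norm_num)
  · exact key 8 _ _ (by norm_num) h (sieve 2073) (by norm_num)
  · exact key 9 _ _ (by norm_num) h (sieve 6919) (by norm_num)
  · exact key 10 _ _ (by norm_num) h (sieve 7171) (by norm_num)
  · exact key 11 _ _ (by norm_num) h (sieve 83501) (by norm_num)
  · exact key 12 _ _ (by norm_num) h (sieve 85811) (by norm_num)
  · have hl := log_lower 1145993 10 201 (by norm_num) (by norm_num) (by decide +kernel)
    have hp := pi_num 1145993 8 1.082 _ (by norm_num) (by norm_num) (by norm_num)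
      (theta_le_c _ (by positivity)) (by norm_num) hl
    refine finish 13 (by norm_num) _ (le_of_eq_of_le (congrArg (fun x => (Nat.primeCounting x : ℝ)) h) hp) (by norm_num)
  · have hl := log_lower 42142223 10 253 (by norm_num) (by norm_num) (by decide +kernel)
    have hp := pi_num 42142223 10 1.082 _ (by norm_num) (by norm_num) (by norm_num)
      (theta_le_c _ (by positivity)) (by norm_num) hl
    refine finish 17 (by norm_num) _ (le_of_eq_of_le (congrArg (fun x => (Nat.primeCounting x : ℝ)) h) hp) (by norm_num)
  · have hl := log_lower 825887397 10 296 (by norm_num) (by norm_num) (by decide +kernel)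
    have hp := pi_num 825887397 12 1.0692 _ (by norm_num) (by norm_num) (by norm_num)
      (theta_le_sharp _ (by norm_num) (by norm_num)) (by norm_num) hl
    refine finish 19 (by norm_num) _ (le_of_eq_of_le (congrArg (fun x => (Nat.primeCounting x : ℝ)) h) hp) (by norm_num)
  · have hl := log_lower 290774257297357 1 48 (by norm_num) (by norm_num) (by decide +kernel)
    have hp := pi_num 290774257297357 20 1.0692 _ (by norm_num) (by norm_num) (by norm_num)
      (theta_le_sharp _ (by norm_num) (by norm_num)) (by norm_num) hl
    refine finish 31 (by norm_num) _ (le_of_eq_of_le (congrArg (fun x => (Nat.primeCounting x : ℝ)) h) hp) (by norm_num)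
  · have hl := log_lower 586061125622639 1 49 (by norm_num) (by norm_num) (by decide +kernel)
    have hp := pi_num 586061125622639 20 1.082 _ (by norm_num) (by norm_num) (by norm_num)
      (theta_le_c _ (by positivity)) (by norm_num) hl
    refine finish 32 (by norm_num) _ (le_of_eq_of_le (congrArg (fun x => (Nat.primeCounting x : ℝ)) h) hp) (by norm_num)

end

theorem primeCounting_g_le (m : ℕ) (hm : 1 ≤ m) :
    (Nat.primeCounting (gNat m) : ℝ) ≤
      18 * 3 ^ m / ((m : ℝ) * Real.log (18 * 3 ^ m)) := by
  rcases le_or_gt m 207 with h | h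
  · rcases g_small m hm h with h1 | ⟨h1, h2⟩
    · exact case_tbl m h1
    · exact case_mid m hm h1 h2
  · exact case_big m (by omega)
end

section
/- For every real x ≥ 13, the number of elements of 𝒰 not exceeding x is at least 2x/ln x. -/
/-- `N ∈ 𝒰` iff `N ≥ 1` and `∑_{n=1}^{N-1} w_n/n ≠ 1/N` for all `w_n ∈ {-1,0,1}`. -/
def memU (N : ℕ) : Prop :=
  1 ≤ N ∧ ∀ w : ℕ → ℤ, (∀ n, w n = -1 ∨ w n = 0 ∨ w n = 1) →
    ∑ n ∈ Finset.Icc 1 (N - 1), (w n : ℚ) / (n : ℚ) ≠ 1 / (N : ℚ)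

open scoped Classical

/-- `|𝒰(x)|`: the number of elements of `𝒰` not exceeding `x`. -/
noncomputable def countU (x : ℝ) : ℕ :=
  ((Finset.Icc 1 ⌊x⌋₊).filter (fun m => memU m)).card

theorem memU_aux (p e m : ℕ) (hp : p.Prime) (he : 1 ≤ e) (hm : 1 ≤ m)
    (H : ∀ w : ℕ → ℤ, (∀ n, w n = -1 ∨ w n = 0 ∨ w n = 1) →
      ∃ K L : ℤ, ¬ (p : ℤ) ∣ K ∧ L ≠ 0 ∧
        ∑ j ∈ Finset.Icc 1 (m - 1), (w j : ℚ) / (j : ℚ) - 1 / (m : ℚ) = K / L) :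
    memU (p ^ e * m) := by
  have hq : 0 < p ^ e := pow_pos hp.pos e
  have : Fact p.Prime := ⟨hp⟩
  refine ⟨Nat.mul_pos hq hm, fun w hw hsum => ?_⟩
  obtain ⟨K, L, hK, hL, hKL⟩ := H (fun j => w (p ^ e * j)) (fun n => hw _)
  set q := p ^ e with hqdef
  have hq0 : (q : ℚ) ≠ 0 := by exact_mod_cast hq.ne'
  rw [← Finset.sum_filter_add_sum_filter_not _ (fun n => q ∣ n)] at hsum
  have himg : (Finset.Icc 1 (q * m - 1)).filter (fun n => q ∣ n)
      = (Finset.Icc 1 (m - 1)).image (fun j => q * j) := by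
    ext n
    simp only [Finset.mem_filter, Finset.mem_Icc, Finset.mem_image]
    constructor
    · rintro ⟨⟨h1, h2⟩, ⟨j, rfl⟩⟩
      refine ⟨j, ⟨?_, ?_⟩, rfl⟩
      · rcases Nat.eq_zero_or_pos j with rfl | h
        · simp at h1
        · exact h
      · have : q * j < q * m := by
          have : 0 < q * m := Nat.mul_pos hq hm
          omega
        have := Nat.lt_of_mul_lt_mul_left this
        omega
    · rintro ⟨j, ⟨h1, h2⟩, rfl⟩
      have h3 : 0 < q * j := Nat.mul_pos hq h1
      have h4 : q * j < q * m := Nat.mul_lt_mul_of_pos_left (by omega) hq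
      exact ⟨⟨h3, by omega⟩, Dvd.intro _ rfl⟩
  rw [himg, Finset.sum_image (fun a _ b _ h => Nat.eq_of_mul_eq_mul_left hq h)] at hsum
  have h1 : ∑ j ∈ Finset.Icc 1 (m - 1), (w (q * j) : ℚ) / ((q * j : ℕ) : ℚ)
      = (1 / q) * ∑ j ∈ Finset.Icc 1 (m - 1), (w (q * j) : ℚ) / (j : ℚ) := by
    rw [Finset.mul_sum]
    refine Finset.sum_congr rfl fun j hj => ?_
    have : (j : ℚ) ≠ 0 := by
      have := (Finset.mem_Icc.mp hj).1
      exact_mod_cast (by omega : j ≠ 0)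
    push_cast
    field_simp
  rw [h1] at hsum
  have hm0 : (m : ℚ) ≠ 0 := by exact_mod_cast (by omega : m ≠ 0)
  have h2 : ∑ n ∈ (Finset.Icc 1 (q * m - 1)).filter (fun n => ¬ q ∣ n), (w n : ℚ) / (n : ℚ)
      = -((1 / q) * (K / L)) := by
    rw [← hKL]
    push_cast at hsum ⊢
    have : (1 : ℚ) / (q * m) = 1 / q * (1 / m) := by field_simp
    rw [this] at hsum
    linear_combination hsum
  have hpe : (0 : ℚ) < (p : ℚ) ^ e := by
    have := hp.pos
    positivity
  have hqn : padicNorm p (1 / (q : ℚ)) = (p : ℚ) ^ e := by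
    have hp0 : (p : ℚ) ≠ 0 := by exact_mod_cast hp.ne_zero
    rw [padicNorm.div, padicNorm.one, hqdef, Nat.cast_pow]
    rw [IsAbsoluteValue.abv_pow (padicNorm p), padicNorm.padicNorm_p_of_prime]
    simp
  have hbig : (p : ℚ) ^ e ≤ padicNorm p (-((1 / q) * (K / L))) := by
    rw [padicNorm.neg, padicNorm.mul, hqn, padicNorm.div]
    have hK1 : padicNorm p K = 1 := by
      rw [padicNorm.int_eq_one_iff]; exact hK
    rw [hK1]
    have hL1 : padicNorm p (L : ℚ) ≤ 1 := padicNorm.of_int L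
    have hL0 : 0 < padicNorm p (L : ℚ) := by
      apply lt_of_le_of_ne (padicNorm.nonneg _)
      exact (padicNorm.nonzero (by exact_mod_cast hL)).symm
    have : 1 ≤ 1 / padicNorm p (L : ℚ) := by
      rw [le_div_iff₀ hL0]; linarith
    nlinarith
  have hsmall : padicNorm p (∑ n ∈ (Finset.Icc 1 (q * m - 1)).filter (fun n => ¬ q ∣ n),
      (w n : ℚ) / (n : ℚ)) < (p : ℚ) ^ e := by
    apply padicNorm.sum_lt' _ hpe
    intro n hn
    have hnd := (Finset.mem_filter.mp hn).2
    have hn1 := (Finset.mem_Icc.mp (Finset.mem_filter.mp hn).1).1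
    have hw1 : padicNorm p (w n : ℚ) ≤ 1 := padicNorm.of_int _
    have h3 : (p : ℚ) ^ (-(e : ℤ)) < padicNorm p (n : ℚ) := by
      rw [← not_le]
      intro h
      apply hnd
      have := (padicNorm.dvd_iff_norm_le (p := p) (n := e) (z := (n : ℤ))).mpr (by exact_mod_cast h)
      rw [hqdef]
      exact_mod_cast this
    rw [zpow_neg, zpow_natCast] at h3
    have hn0 : 0 < padicNorm p (n : ℚ) := lt_trans (by positivity) h3
    rw [padicNorm.div, div_lt_iff₀ hn0]
    rw [inv_lt_iff_one_lt_mul₀ hpe] at h3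
    linarith
  rw [h2] at hsmall
  exact absurd hsmall (not_lt.mpr hbig)

theorem memU_pow (p e : ℕ) (hp : p.Prime) (he : 1 ≤ e) : memU (p ^ e) := by
  have := memU_aux p e 1 hp he le_rfl (fun w hw => ⟨-1, 1, ?_, by norm_num, by simp⟩)
  · simpa using this
  · have := hp.one_lt
    intro h
    have := Int.le_of_dvd (by norm_num) ((dvd_neg).mp h)
    omega

theorem not_dvd_aux (p : ℕ) (K : ℤ) (B : ℕ) (hB : B < p) (h0 : K ≠ 0) (h : |K| ≤ B) :
    ¬ (p : ℤ) ∣ K := by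
  intro hd
  exact h0 (Int.eq_zero_of_abs_lt_dvd hd (by omega))

def BB (m : ℕ) : ℕ :=
  if m = 1 then 1 else if m = 2 then 3 else if m = 3 then 11 else if m = 4 then 25 else 137

theorem memU_mul (p m : ℕ) (hp : p.Prime) (hm1 : 1 ≤ m) (hm5 : m ≤ 5) (hB : BB m < p) :
    memU (m * p) := by
  rw [mul_comm]
  have := memU_aux p 1 m hp le_rfl hm1 ?_
  · simpa using this
  intro w hw
  have a1 := hw 1
  have a2 := hw 2
  have a3 := hw 3
  have a4 := hw 4
  interval_cases m
  · refine ⟨-1, 1, not_dvd_aux p _ _ hB (by norm_num) (by simp [BB]), by norm_num, by simp⟩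
  · refine ⟨2 * w 1 - 1, 2, not_dvd_aux p _ _ hB (by omega) ?_, by norm_num, ?_⟩
    · rw [abs_le]; simp [BB]; omega
    · simp; ring
  · refine ⟨6 * w 1 + 3 * w 2 - 2, 6, not_dvd_aux p _ _ hB (by omega) ?_, by norm_num, ?_⟩
    · rw [abs_le]; simp [BB]; omega
    · simp [Finset.sum_Icc_succ_top]; ring
  · refine ⟨12 * w 1 + 6 * w 2 + 4 * w 3 - 3, 12, not_dvd_aux p _ _ hB (by omega) ?_,
      by norm_num, ?_⟩
    · rw [abs_le]; simp [BB]; omega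
    · simp [Finset.sum_Icc_succ_top]; ring
  · refine ⟨60 * w 1 + 30 * w 2 + 20 * w 3 + 15 * w 4 - 12, 60, not_dvd_aux p _ _ hB (by omega) ?_,
      by norm_num, ?_⟩
    · rw [abs_le]; simp [BB]; omega
    · simp [Finset.sum_Icc_succ_top]; ring

open ArithmeticFunction in
theorem log_fact_eq (N M : ℕ) (h : M ≤ N) :
    Real.log (M.factorial : ℝ) = ∑ n ∈ Finset.Ioc 0 N, Λ n * ((M / n : ℕ) : ℝ) := by
  induction M with
  | zero => simp
  | succ M ih =>
    rw [Nat.factorial_succ, Nat.cast_mul, Real.log_mul (by positivity) (by positivity),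
      ih (by omega), ← vonMangoldt_sum]
    have : ∑ i ∈ (M + 1).divisors, Λ i = ∑ n ∈ Finset.Ioc 0 N, if n ∣ M + 1 then Λ n else 0 := by
      rw [← Finset.sum_filter]
      refine Finset.sum_congr ?_ fun _ _ => rfl
      ext n
      simp only [Nat.mem_divisors, Finset.mem_filter, Finset.mem_Ioc]
      constructor
      · rintro ⟨h1, _⟩
        have := Nat.le_of_dvd (by omega) h1
        have := Nat.pos_of_dvd_of_pos h1 (by omega)
        exact ⟨⟨by omega, by omega⟩, h1⟩
      · rintro ⟨_, h1⟩
        exact ⟨h1, by omega⟩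
    rw [this, ← Finset.sum_add_distrib]
    refine Finset.sum_congr rfl fun n _ => ?_
    rw [Nat.succ_div]
    split_ifs <;> push_cast <;> ring

open ArithmeticFunction in
theorem psi_lower (N : ℕ) :
    Real.log (N.factorial : ℝ) - Real.log ((N / 2).factorial : ℝ)
      - Real.log ((N / 3).factorial : ℝ) - Real.log ((N / 5).factorial : ℝ)
      + Real.log ((N / 30).factorial : ℝ) ≤ Chebyshev.psi N := by
  rw [log_fact_eq N N le_rfl, log_fact_eq N (N / 2) (Nat.div_le_self _ _),
    log_fact_eq N (N / 3) (Nat.div_le_self _ _), log_fact_eq N (N / 5) (Nat.div_le_self _ _),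
    log_fact_eq N (N / 30) (Nat.div_le_self _ _), Chebyshev.psi, Nat.floor_natCast,
    ← Finset.sum_sub_distrib, ← Finset.sum_sub_distrib, ← Finset.sum_sub_distrib,
    ← Finset.sum_add_distrib]
  refine Finset.sum_le_sum fun n _ => ?_
  have hc : ∀ k, N / k / n = N / n / k := fun k => by
    rw [Nat.div_div_eq_div_mul, Nat.div_div_eq_div_mul, mul_comm]
  rw [hc, hc, hc, hc]
  generalize N / n = M
  have h : M + M / 30 ≤ 1 + M / 2 + M / 3 + M / 5 := by omega
  have h' : ((M : ℕ) : ℝ) + (M / 30 : ℕ) ≤ 1 + (M / 2 : ℕ) + (M / 3 : ℕ) + (M / 5 : ℕ) := by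
    exact_mod_cast h
  have := vonMangoldt_nonneg (n := n)
  nlinarith

theorem f_mono {a b : ℝ} (ha : 1 ≤ a) (hab : a ≤ b) :
    a * Real.log a - a ≤ b * Real.log b - b := by
  have h0 : 0 < a := by linarith
  have hb : 0 < b := by linarith
  have h1 := Real.log_le_sub_one_of_pos (div_pos h0 hb)
  rw [Real.log_div h0.ne' hb.ne'] at h1
  have h2 : b * (a / b - 1) = a - b := by field_simp
  have h3 : 0 ≤ Real.log a := Real.log_nonneg ha
  have h4 : b * (Real.log a - Real.log b) ≤ a - b := by
    rw [← h2]; exact mul_le_mul_of_nonneg_left h1 hb.le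
  nlinarith

theorem log_fact_le (n : ℕ) (hn : 1 ≤ n) :
    Real.log (n.factorial : ℝ) ≤ n * Real.log n - n + 1 + Real.log n := by
  induction n, hn using Nat.le_induction with
  | base => simp
  | succ n hn ih =>
    rw [Nat.factorial_succ, Nat.cast_mul, Real.log_mul (by positivity) (by positivity)]
    have h0 : (0 : ℝ) < n := by exact_mod_cast hn
    have h1 := Real.log_le_sub_one_of_pos (show (0:ℝ) < (n / (n + 1 : ℝ)) by positivity)
    rw [Real.log_div (by positivity) (by positivity)] at h1
    have h2 : ((n:ℝ) + 1) * (n / (n + 1 : ℝ) - 1) = -1 := by field_simp; ring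
    have h3 := mul_le_mul_of_nonneg_left h1 (by positivity : (0:ℝ) ≤ n + 1)
    push_cast
    nlinarith

theorem le_log_fact (n : ℕ) (hn : 1 ≤ n) :
    n * Real.log n - n + 1 ≤ Real.log (n.factorial : ℝ) := by
  induction n, hn using Nat.le_induction with
  | base => simp
  | succ n hn ih =>
    rw [Nat.factorial_succ, Nat.cast_mul, Real.log_mul (by positivity) (by positivity)]
    have h0 : (0 : ℝ) < n := by exact_mod_cast hn
    have h1 := Real.log_le_sub_one_of_pos (show (0:ℝ) < ((n + 1 : ℝ) / n) by positivity)
    rw [Real.log_div (by positivity) (by positivity)] at h1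
    have h2 : (n:ℝ) * ((n + 1 : ℝ) / n - 1) = 1 := by field_simp; ring
    have h3 := mul_le_mul_of_nonneg_left h1 h0.le
    push_cast
    nlinarith

theorem T_le (y : ℝ) (hy : 1 ≤ y) :
    Real.log (⌊y⌋₊.factorial : ℝ) ≤ y * Real.log y - y + 1 + Real.log y := by
  have h1 : 1 ≤ ⌊y⌋₊ := Nat.le_floor (by simpa using hy)
  have h1' : (1 : ℝ) ≤ ⌊y⌋₊ := by exact_mod_cast h1
  have h2 : (⌊y⌋₊ : ℝ) ≤ y := Nat.floor_le (by linarith)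
  have h3 := log_fact_le _ h1
  have h4 := f_mono h1' h2
  have h5 := Real.log_le_log (by linarith) h2
  linarith

theorem le_T (y : ℝ) (hy : 1 ≤ y) :
    y * Real.log y - y + 1 - Real.log (y + 1) ≤ Real.log (⌊y⌋₊.factorial : ℝ) := by
  have h2 : (⌊y⌋₊ : ℝ) ≤ y := Nat.floor_le (by linarith)
  have h2' : y ≤ ((⌊y⌋₊ + 1 : ℕ) : ℝ) := by push_cast; exact (Nat.lt_floor_add_one y).le
  have h3 := le_log_fact (⌊y⌋₊ + 1) (by omega)
  have h4 := f_mono hy h2'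
  rw [Nat.factorial_succ, Nat.cast_mul, Real.log_mul (by positivity) (by positivity)] at h3
  have h5 : Real.log ((⌊y⌋₊ + 1 : ℕ) : ℝ) ≤ Real.log (y + 1) :=
    Real.log_le_log (by positivity) (by push_cast; linarith)
  linarith

theorem log3_gt : (1.0974 : ℝ) < Real.log 3 := by
  have h : Real.log ((2:ℝ) ^ 19) ≤ Real.log ((3:ℝ) ^ 12) :=
    Real.log_le_log (by norm_num) (by norm_num)
  rw [Real.log_pow, Real.log_pow] at h
  have := Real.log_two_gt_d9
  push_cast at h
  linarith

theorem log5_gt : (1.609 : ℝ) < Real.log 5 := by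
  have h : Real.log ((2:ℝ) ^ 65) ≤ Real.log ((5:ℝ) ^ 28) :=
    Real.log_le_log (by norm_num) (by norm_num)
  rw [Real.log_pow, Real.log_pow] at h
  have := Real.log_two_gt_d9
  push_cast at h
  linarith

theorem psi_lower' (x : ℝ) (hx : 30 ≤ x) :
    0.92 * x - 5 * Real.log x ≤ Chebyshev.psi x := by
  rw [Chebyshev.psi_eq_psi_coe_floor]
  refine le_trans ?_ (psi_lower _)
  rw [← Nat.floor_div_ofNat, ← Nat.floor_div_ofNat, ← Nat.floor_div_ofNat, ← Nat.floor_div_ofNat]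
  have t1 := le_T x (by linarith)
  have t2 := T_le (x / 2) (by linarith)
  have t3 := T_le (x / 3) (by linarith)
  have t5 := T_le (x / 5) (by linarith)
  have t30 := le_T (x / 30) (by linarith)
  have hx0 : 0 < x := by linarith
  have l30 : Real.log 30 = Real.log 2 + Real.log 3 + Real.log 5 := by
    rw [← Real.log_mul (by norm_num) (by norm_num), ← Real.log_mul (by norm_num) (by norm_num)]
    norm_num
  have e1 : Real.log (x + 1) ≤ Real.log x + Real.log 2 := by
    rw [← Real.log_mul (by positivity) (by norm_num)]
    exact Real.log_le_log (by positivity) (by linarith)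
  have e2 : Real.log (x / 30 + 1) ≤ Real.log x := 
    Real.log_le_log (by positivity) (by linarith)
  rw [Real.log_div (by positivity) (by norm_num)] at t2 t3 t5 t30
  rw [l30] at t30
  have a := Real.log_two_gt_d9
  have a' := Real.log_two_lt_d9
  have b := log3_gt
  have c := log5_gt
  have m2 := mul_lt_mul_of_pos_right a hx0
  have m3 := mul_lt_mul_of_pos_right b hx0
  have m5 := mul_lt_mul_of_pos_right c hx0
  nlinarith

theorem pi_lower (x : ℝ) (hx : 30 ≤ x) :
    0.92 * x / Real.log x - 5 ≤ (Nat.primeCounting ⌊x⌋₊ : ℝ) := by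
  have h := (psi_lower' x hx).trans (Chebyshev.psi_le_primeCounting_mul_log' x)
  have hl : 0 < Real.log x := Real.log_pos (by linarith)
  rw [sub_le_iff_le_add, div_le_iff₀ hl]
  linarith

theorem f_div_mono {a b : ℝ} (ha : 13 ≤ a) (hab : a ≤ b) :
    2 * a / Real.log a ≤ 2 * b / Real.log b := by
  have he : Real.exp 1 ≤ 13 := by have := Real.exp_one_lt_d9; linarith
  have h := Real.log_div_self_antitoneOn (show a ∈ {x | Real.exp 1 ≤ x} by simp; linarith)
    (show b ∈ {x | Real.exp 1 ≤ x} by simp; linarith) hab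
  have hla : 0 < Real.log a := Real.log_pos (by linarith)
  have hlb : 0 < Real.log b := Real.log_pos (by linarith)
  simp only at h
  rw [div_le_div_iff₀ (by linarith) (by linarith)] at h
  rw [div_le_div_iff₀ hla hlb]
  nlinarith

def PP : ℕ := 32589158477190044730

theorem dvd_PP : ∀ r < 55, r.Prime → r ∣ PP := by
  unfold PP
  intro r hr hp
  interval_cases r <;> first | (exfalso; revert hp; norm_num; done) | norm_num

def isP (n : ℕ) : Bool :=
  (decide (1 < n) && Nat.gcd n PP == 1) ||
  [2, 3, 5, 7, 11, 13, 17, 19, 23, 29, 31, 37, 41, 43, 47, 53].elem n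

theorem isP_prime (n : ℕ) (hn : n < 3000) (h : isP n = true) : n.Prime := by
  unfold isP at h
  rw [Bool.or_eq_true] at h
  rcases h with h | h
  · rw [Bool.and_eq_true, decide_eq_true_eq, beq_iff_eq] at h
    by_contra hnp
    have h1 := Nat.minFac_sq_le_self (by omega) hnp
    have h2 : n.minFac < 55 := by nlinarith
    have h3 := Nat.minFac_prime (n := n) (by omega)
    have h4 := Nat.dvd_gcd (Nat.minFac_dvd n) (dvd_PP _ h2 h3)
    rw [h.2] at h4
    exact h3.one_lt.ne' (Nat.dvd_one.mp h4)
  · rw [List.elem_iff] at h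
    simp only [List.mem_cons, List.not_mem_nil, or_false] at h
    rcases h with h | h | h | h | h | h | h | h | h | h | h | h | h | h | h | h <;> subst h <;>
      norm_num

def gm (m n : ℕ) : Bool := n % m == 0 && (decide (BB m < n / m) && isP (n / m))

def gg (n : ℕ) : Bool :=
  [1, 4, 8, 9, 16, 25, 27, 32, 49].elem n || (gm 1 n || (gm 2 n || (gm 3 n || (gm 4 n || gm 5 n))))

theorem gm_memU (m n : ℕ) (hm1 : 1 ≤ m) (hm5 : m ≤ 5) (hn : n < 3000) (h : gm m n = true) :
    memU n := by
  unfold gm at h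
  rw [Bool.and_eq_true, Bool.and_eq_true, decide_eq_true_eq, beq_iff_eq] at h
  obtain ⟨h1, h2, h3⟩ := h
  have h4 : m * (n / m) = n := Nat.mul_div_cancel' (Nat.dvd_of_mod_eq_zero h1)
  rw [← h4]
  exact memU_mul _ _ (isP_prime _ (lt_of_le_of_lt (Nat.div_le_self _ _) hn) h3) hm1 hm5 h2

theorem memU_one : memU 1 := by
  refine ⟨le_rfl, fun w _ => by simp⟩

theorem gg_memU (n : ℕ) (hn : n < 3000) (h : gg n = true) : memU n := by
  unfold gg at h
  simp only [Bool.or_eq_true] at h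
  rcases h with h | h | h | h | h | h
  · rw [List.elem_iff] at h
    simp only [List.mem_cons, List.not_mem_nil, or_false] at h
    rcases h with h | h | h | h | h | h | h | h | h
    · rw [h]; exact memU_one
    · rw [h]; exact memU_pow 2 2 (by norm_num) (by norm_num)
    · rw [h]; exact memU_pow 2 3 (by norm_num) (by norm_num)
    · rw [h]; exact memU_pow 3 2 (by norm_num) (by norm_num)
    · rw [h]; exact memU_pow 2 4 (by norm_num) (by norm_num)
    · rw [h]; exact memU_pow 5 2 (by norm_num) (by norm_num)
    · rw [h]; exact memU_pow 3 3 (by norm_num) (by norm_num)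
    · rw [h]; exact memU_pow 2 5 (by norm_num) (by norm_num)
    · rw [h]; exact memU_pow 7 2 (by norm_num) (by norm_num)
  all_goals exact gm_memU _ n (by norm_num) (by norm_num) hn h

def cnt : ℕ → ℕ
  | 0 => 0
  | n + 1 => (bif gg (n + 1) then 1 else 0) + cnt n

theorem cnt_le (n : ℕ) (hn : n < 3000) :
    cnt n ≤ ((Finset.Icc 1 n).filter (fun m => memU m)).card := by
  induction n with
  | zero => simp [cnt]
  | succ n ih =>
    have ih := ih (by omega)
    rw [← Finset.insert_Icc_right_eq_Icc_add_one (by omega), Finset.filter_insert]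
    simp only [cnt]
    cases h : gg (n + 1) with
    | false =>
      simp only [cond_false]
      refine le_trans (by omega : _ ≤ ((Finset.Icc 1 n).filter (fun m => memU m)).card)
        (Finset.card_le_card ?_)
      split_ifs
      · exact Finset.subset_insert _ _
      · exact subset_rfl
    | true =>
      rw [if_pos (gg_memU _ hn h), Finset.card_insert_of_notMem (by simp)]
      simp only [cond_true]
      omega

theorem step (a b c r s : ℕ) (hc : c ≤ cnt a) (ha : 13 ≤ a) (ha' : a < 3000) (hs : 0 < s)
    (hc0 : 0 < c) (hrs : 2 * b * s ≤ c * r) (he : (2.7182818286 : ℝ) ^ r ≤ (b : ℝ) ^ s)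
    (x : ℝ) (h1 : (a : ℝ) ≤ x) (h2 : x ≤ b) : 2 * x / Real.log x ≤ (countU x : ℝ) := by
  have ha13 : (13 : ℝ) ≤ a := by exact_mod_cast ha
  have hb : (13 : ℝ) ≤ b := by linarith
  refine (f_div_mono (by linarith) h2).trans ?_
  have hcc : c ≤ countU x := by
    refine hc.trans ((cnt_le a ha').trans ?_)
    unfold countU
    refine Finset.card_le_card (Finset.filter_subset_filter _ (Finset.Icc_subset_Icc_right ?_))
    exact Nat.le_floor h1
  have hcc' : (c : ℝ) ≤ countU x := by exact_mod_cast hcc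
  refine le_trans ?_ hcc'
  have hlb : 0 < Real.log b := Real.log_pos (by linarith)
  rw [div_le_iff₀ hlb]
  have he' : Real.exp r ≤ (b : ℝ) ^ s := by
    refine le_trans ?_ he
    rw [← Real.exp_one_pow]
    exact pow_le_pow_left₀ (Real.exp_pos _).le Real.exp_one_lt_d9.le _
  have h3 : (r : ℝ) ≤ s * Real.log b := by
    rw [← Real.log_pow, Real.le_log_iff_exp_le (by positivity)]
    exact he'
  have hs' : (0 : ℝ) < s := by exact_mod_cast hs
  have h4 : (2 * b * s : ℝ) ≤ c * r := by exact_mod_cast hrs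
  have hc0' : (0 : ℝ) < c := by exact_mod_cast hc0
  nlinarith [mul_le_mul_of_nonneg_left h3 hc0'.le]

def CC (m : ℕ) : ℕ := if m = 2 then 5 else BB m

noncomputable def AA (x : ℝ) (m : ℕ) : Finset ℕ :=
  ((Finset.Ioc (CC m) ⌊x / m⌋₊).filter Nat.Prime).image (fun p => m * p)

theorem card_AA (x : ℝ) (m : ℕ) (hm : 1 ≤ m) :
    Nat.primeCounting ⌊x / m⌋₊ ≤ (AA x m).card + Nat.primeCounting (CC m) := by
  unfold AA
  rw [Finset.card_image_of_injective _ (fun a b h => Nat.eq_of_mul_eq_mul_left hm h),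
    ← Nat.primesLE_card_eq_primeCounting, ← Nat.primesLE_card_eq_primeCounting]
  refine le_trans (Finset.card_le_card ?_) (Finset.card_union_le _ _)
  intro p hp
  rw [Nat.mem_primesLE] at hp
  rw [Finset.mem_union, Finset.mem_filter, Finset.mem_Ioc, Nat.mem_primesLE]
  by_cases h : p ≤ CC m
  · right; exact ⟨h, hp.2⟩
  · left; exact ⟨⟨by omega, hp.1⟩, hp.2⟩

theorem BB_le_CC (m : ℕ) : BB m ≤ CC m := by
  unfold CC
  split_ifs with h
  · subst h; decide
  · rfl

theorem five_le_CC (m : ℕ) (h1 : m ≠ 1) : 5 ≤ CC m := by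
  unfold CC BB
  split_ifs <;> omega

theorem AA_subset (x : ℝ) (m : ℕ) (hx : 0 ≤ x) (hm : 1 ≤ m) (hm5 : m ≤ 5) :
    AA x m ⊆ (Finset.Icc 1 ⌊x⌋₊).filter (fun m => memU m) := by
  intro n hn
  unfold AA at hn
  rw [Finset.mem_image] at hn
  obtain ⟨p, hp, rfl⟩ := hn
  rw [Finset.mem_filter, Finset.mem_Ioc] at hp
  obtain ⟨⟨h1, h2⟩, h3⟩ := hp
  have hM := memU_mul p m h3 hm hm5 (lt_of_le_of_lt (BB_le_CC m) h1)
  rw [Finset.mem_filter, Finset.mem_Icc]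
  refine ⟨⟨hM.1, ?_⟩, hM⟩
  rw [Nat.floor_div_natCast] at h2
  calc m * p ≤ m * (⌊x⌋₊ / m) := Nat.mul_le_mul_left _ h2
    _ ≤ _ := Nat.mul_div_le _ _

theorem AA_disj_aux (m m' p p' : ℕ) (hm' : 1 ≤ m') (hm5' : m' ≤ 5) (hp : p.Prime) 
    (hp' : p'.Prime) (hpp : 5 < p) (h : m * p = m' * p') : m = m' := by
  have h1 : p ∣ m' * p' := ⟨m, by rw [← h, mul_comm]⟩
  rcases (Nat.Prime.dvd_mul hp).mp h1 with h2 | h2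
  · have := Nat.le_of_dvd (by omega) h2
    omega
  · rw [Nat.prime_dvd_prime_iff_eq hp hp'] at h2
    subst h2
    exact Nat.eq_of_mul_eq_mul_right hp.pos h

theorem sum_AA (x : ℝ) (hx : 0 ≤ x) : ∑ m ∈ Finset.Icc 1 5, (AA x m).card ≤ countU x := by
  rw [← Finset.card_biUnion]
  · unfold countU
    refine Finset.card_le_card ?_
    rw [Finset.biUnion_subset]
    intro m hm
    rw [Finset.mem_Icc] at hm
    exact AA_subset x m hx hm.1 hm.2
  · intro m hm m' hm' hne
    simp only [Finset.coe_Icc, Set.mem_Icc, Finset.mem_Icc] at hm hm'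
    rw [Function.onFun, Finset.disjoint_left]
    intro n hn hn'
    unfold AA at hn hn'
    rw [Finset.mem_image] at hn hn'
    obtain ⟨p, hp, rfl⟩ := hn
    obtain ⟨p', hp', h⟩ := hn'
    rw [Finset.mem_filter, Finset.mem_Ioc] at hp hp'
    by_cases h1 : m = 1
    · have := five_le_CC m' (by omega)
      exact hne (AA_disj_aux m' m p' p hm.1 hm.2 hp'.2 hp.2 (by omega) h).symm
    · have := five_le_CC m h1
      exact hne (AA_disj_aux m m' p p' hm'.1 hm'.2 hp.2 hp'.2 (by omega) h.symm)

theorem part_lower (x : ℝ) (hx : 3000 ≤ x) (m : ℕ) (hm : 1 ≤ m) (hm5 : m ≤ 5) (l : ℝ)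
    (hl0 : 0 ≤ l) (hl : l ≤ Real.log m) :
    0.92 * (x / m) * (Real.log x + l) / Real.log x ^ 2 - 5 ≤ Nat.primeCounting ⌊x / m⌋₊ := by
  have hm0 : (0 : ℝ) < m := by exact_mod_cast hm
  have hm5' : (m : ℝ) ≤ 5 := by exact_mod_cast hm5
  have h30 : 30 ≤ x / m := by rw [le_div_iff₀ hm0]; linarith
  have h := pi_lower (x / m) h30
  refine le_trans ?_ h
  have hL : 0 < Real.log x := Real.log_pos (by linarith)
  have hL' : 0 < Real.log (x / m) := Real.log_pos (by linarith)
  have e : Real.log (x / m) = Real.log x - Real.log m :=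
    Real.log_div (by linarith) hm0.ne'
  have : 0.92 * (x / m) * (Real.log x + l) / Real.log x ^ 2 ≤ 0.92 * (x / m) / Real.log (x / m) := by
    rw [div_le_div_iff₀ (by positivity) hL', mul_assoc]
    refine mul_le_mul_of_nonneg_left ?_ (by linarith)
    nlinarith
  linarith

theorem key_ineq (x L : ℝ) (hx0 : 0 < x) (hL8 : 8 ≤ L) (hLp : 0 < L)
    (hE : 2900 * (1 + (L - 8) + (L - 8) ^ 2 / 2) ≤ x) :
    2 * x / L + 75 ≤ 0.92 * (x / (1 : ℕ)) * (L + 0) / L ^ 2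
      + 0.92 * (x / (2 : ℕ)) * (L + 0.69) / L ^ 2 + 0.92 * (x / (3 : ℕ)) * (L + 1.09) / L ^ 2
      + 0.92 * (x / (4 : ℕ)) * (L + 1.38) / L ^ 2 + 0.92 * (x / (5 : ℕ)) * (L + 1.6) / L ^ 2 := by
  have e1 : 2 * x / L + 75 = (2 * x * L + 75 * L ^ 2) / L ^ 2 := by field_simp
  rw [e1, ← add_div, ← add_div, ← add_div, ← add_div]
  refine div_le_div_of_nonneg_right ?_ (by positivity)
  push_cast
  have : 75 * L ^ 2 ≤ x * (0.1 * L + 1.25) := by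
    have h1 : 2900 * (1 + (L - 8) + (L - 8) ^ 2 / 2) * 2.05 ≤ x * (0.1 * L + 1.25) :=
      mul_le_mul hE (by linarith) (by norm_num) hx0.le
    nlinarith [sq_nonneg (L - 8)]
  have h9 := mul_pos hx0 hLp
  have h10 : x * (0.1 * L + 1.25) = 0.1 * (x * L) + 1.25 * x := by ring
  linarith

theorem large (x : ℝ) (hx : 3000 ≤ x) : 2 * x / Real.log x ≤ (countU x : ℝ) := by
  have hs := sum_AA x (by linarith)
  simp only [Finset.sum_Icc_succ_top, Nat.reduceAdd, Nat.reduceLeDiff, Finset.Icc_self,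
    Finset.sum_singleton] at hs
  have c1 := card_AA x 1 (by norm_num)
  have c2 := card_AA x 2 (by norm_num)
  have c3 := card_AA x 3 (by norm_num)
  have c4 := card_AA x 4 (by norm_num)
  have c5 := card_AA x 5 (by norm_num)
  have d1 : Nat.primeCounting (CC 1) = 0 := by decide +kernel
  have d2 : Nat.primeCounting (CC 2) = 3 := by decide +kernel
  have d3 : Nat.primeCounting (CC 3) = 5 := by decide +kernel
  have d4 : Nat.primeCounting (CC 4) = 9 := by decide +kernel
  have d5 : Nat.primeCounting (CC 5) = 33 := by decide +kernel
  have a := Real.log_two_gt_d9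
  have l4 : Real.log 4 = 2 * Real.log 2 := by
    rw [show (4 : ℝ) = 2 ^ 2 by norm_num, Real.log_pow]; norm_num
  have p1 := part_lower x hx 1 (by norm_num) (by norm_num) 0 le_rfl (by simp)
  have p2 := part_lower x hx 2 (by norm_num) (by norm_num) 0.69 (by norm_num)
    (by push_cast; linarith)
  have p3 := part_lower x hx 3 (by norm_num) (by norm_num) 1.09 (by norm_num)
    (by push_cast; linarith [log3_gt])
  have p4 := part_lower x hx 4 (by norm_num) (by norm_num) 1.38 (by norm_num)
    (by push_cast; linarith)
  have p5 := part_lower x hx 5 (by norm_num) (by norm_num) 1.6 (by norm_num)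
    (by push_cast; linarith [log5_gt])
  have hN : Nat.primeCounting ⌊x / (1 : ℕ)⌋₊ + Nat.primeCounting ⌊x / (2 : ℕ)⌋₊
      + Nat.primeCounting ⌊x / (3 : ℕ)⌋₊ + Nat.primeCounting ⌊x / (4 : ℕ)⌋₊
      + Nat.primeCounting ⌊x / (5 : ℕ)⌋₊ ≤ countU x + 50 := by omega
  have hN' : (Nat.primeCounting ⌊x / (1 : ℕ)⌋₊ : ℝ) + Nat.primeCounting ⌊x / (2 : ℕ)⌋₊
      + Nat.primeCounting ⌊x / (3 : ℕ)⌋₊ + Nat.primeCounting ⌊x / (4 : ℕ)⌋₊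
      + Nat.primeCounting ⌊x / (5 : ℕ)⌋₊ ≤ countU x + 50 := by exact_mod_cast hN
  have hx0 : 0 < x := by linarith
  have hL8 : 8 ≤ Real.log x := by
    rw [Real.le_log_iff_exp_le hx0]
    refine le_trans ?_ hx
    rw [show (8 : ℝ) = ((8 : ℕ) : ℝ) by norm_num, ← Real.exp_one_pow]
    refine (pow_le_pow_left₀ (Real.exp_pos _).le Real.exp_one_lt_d9.le _).trans ?_
    norm_num
  have hE : 2900 * (1 + (Real.log x - 8) + (Real.log x - 8) ^ 2 / 2) ≤ x := by
    have h1 := Real.quadratic_le_exp_of_nonneg (show 0 ≤ Real.log x - 8 by linarith)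
    have h2 : (2900 : ℝ) ≤ Real.exp 8 := by
      rw [show (8 : ℝ) = ((8 : ℕ) : ℝ) by norm_num, ← Real.exp_one_pow]
      refine le_trans ?_ (pow_le_pow_left₀ (by norm_num) Real.exp_one_gt_d9.le _)
      norm_num
    have h3 : x = Real.exp 8 * Real.exp (Real.log x - 8) := by
      rw [← Real.exp_add, show 8 + (Real.log x - 8) = Real.log x by ring, Real.exp_log hx0]
    refine le_trans (mul_le_mul h2 h1 ?_ (Real.exp_pos _).le) h3.symm.le
    have h4 : 0 ≤ Real.log x - 8 := by linarith
    positivity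
  have hLp : 0 < Real.log x := by linarith
  have key := key_ineq x (Real.log x) hx0 hL8 hLp hE
  linarith

set_option exponentiation.threshold 1000 in
theorem countU_ge_two (x : ℝ) (hx : 13 ≤ x) :
    2 * x / Real.log x ≤ (countU x : ℝ) := by
  rcases lt_or_ge x 14 with h | h
  · exact step 13 14 11 13 5 (by decide +kernel) (by norm_num) (by norm_num) (by norm_num) (by norm_num) (by norm_num) (by norm_num) x hx h.le
  clear hx
  rename' h => hx
  rcases lt_or_ge x 16 with h | h
  · exact step 14 16 12 8 3 (by decide +kernel) (by norm_num) (by norm_num) (by norm_num) (by norm_num) (by norm_num) (by norm_num) x hx h.le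
  clear hx
  rename' h => hx
  rcases lt_or_ge x 19 with h | h
  · exact step 16 19 13 38 13 (by decide +kernel) (by norm_num) (by norm_num) (by norm_num) (by norm_num) (by norm_num) (by norm_num) x hx h.le
  clear hx
  rename' h => hx
  rcases lt_or_ge x 23 with h | h
  · exact step 19 23 15 25 8 (by decide +kernel) (by norm_num) (by norm_num) (by norm_num) (by norm_num) (by norm_num) (by norm_num) x hx h.le
  clear hx
  rename' h => hx
  rcases lt_or_ge x 28 with h | h
  · exact step 23 28 17 33 10 (by decide +kernel) (by norm_num) (by norm_num) (by norm_num) (by norm_num) (by norm_num) (by norm_num) x hx h.le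
  clear hx
  rename' h => hx
  rcases lt_or_ge x 35 with h | h
  · exact step 28 35 20 7 2 (by decide +kernel) (by norm_num) (by norm_num) (by norm_num) (by norm_num) (by norm_num) (by norm_num) x hx h.le
  clear hx
  rename' h => hx
  rcases lt_or_ge x 45 with h | h
  · exact step 35 45 24 15 4 (by decide +kernel) (by norm_num) (by norm_num) (by norm_num) (by norm_num) (by norm_num) (by norm_num) x hx h.le
  clear hx
  rename' h => hx
  rcases lt_or_ge x 59 with h | h
  · exact step 45 59 29 53 13 (by decide +kernel) (by norm_num) (by norm_num) (by norm_num) (by norm_num) (by norm_num) (by norm_num) x hx h.le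
  clear hx
  rename' h => hx
  rcases lt_or_ge x 81 with h | h
  · exact step 59 81 37 57 13 (by decide +kernel) (by norm_num) (by norm_num) (by norm_num) (by norm_num) (by norm_num) (by norm_num) x hx h.le
  clear hx
  rename' h => hx
  rcases lt_or_ge x 104 with h | h
  · exact step 81 104 45 37 8 (by decide +kernel) (by norm_num) (by norm_num) (by norm_num) (by norm_num) (by norm_num) (by norm_num) x hx h.le
  clear hx
  rename' h => hx
  rcases lt_or_ge x 134 with h | h
  · exact step 104 134 55 39 8 (by decide +kernel) (by norm_num) (by norm_num) (by norm_num) (by norm_num) (by norm_num) (by norm_num) x hx h.le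
  clear hx
  rename' h => hx
  rcases lt_or_ge x 178 with h | h
  · exact step 134 178 69 31 6 (by decide +kernel) (by norm_num) (by norm_num) (by norm_num) (by norm_num) (by norm_num) (by norm_num) x hx h.le
  clear hx
  rename' h => hx
  rcases lt_or_ge x 241 with h | h
  · exact step 178 241 88 126 23 (by decide +kernel) (by norm_num) (by norm_num) (by norm_num) (by norm_num) (by norm_num) (by norm_num) x hx h.le
  clear hx
  rename' h => hx
  rcases lt_or_ge x 334 with h | h
  · exact step 241 334 115 122 21 (by decide +kernel) (by norm_num) (by norm_num) (by norm_num) (by norm_num) (by norm_num) (by norm_num) x hx h.le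
  clear hx
  rename' h => hx
  rcases lt_or_ge x 463 with h | h
  · exact step 334 463 151 92 15 (by decide +kernel) (by norm_num) (by norm_num) (by norm_num) (by norm_num) (by norm_num) (by norm_num) x hx h.le
  clear hx
  rename' h => hx
  rcases lt_or_ge x 643 with h | h
  · exact step 463 643 199 181 28 (by decide +kernel) (by norm_num) (by norm_num) (by norm_num) (by norm_num) (by norm_num) (by norm_num) x hx h.le
  clear hx
  rename' h => hx
  rcases lt_or_ge x 881 with h | h
  · exact step 643 881 260 61 9 (by decide +kernel) (by norm_num) (by norm_num) (by norm_num) (by norm_num) (by norm_num) (by norm_num) x hx h.le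
  clear hx
  rename' h => hx
  rcases lt_or_ge x 1230 with h | h
  · exact step 881 1230 346 64 9 (by decide +kernel) (by norm_num) (by norm_num) (by norm_num) (by norm_num) (by norm_num) (by norm_num) x hx h.le
  clear hx
  rename' h => hx
  rcases lt_or_ge x 1751 with h | h
  · exact step 1230 1751 469 463 62 (by decide +kernel) (by norm_num) (by norm_num) (by norm_num) (by norm_num) (by norm_num) (by norm_num) x hx h.le
  clear hx
  rename' h => hx
  rcases lt_or_ge x 2513 with h | h
  · exact step 1751 2513 642 595 76 (by decide +kernel) (by norm_num) (by norm_num) (by norm_num) (by norm_num) (by norm_num) (by norm_num) x hx h.le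
  clear hx
  rename' h => hx
  rcases lt_or_ge x 3000 with h | h
  · exact step 2513 3000 886 7 1 (by decide +kernel) (by norm_num) (by norm_num) (by norm_num) (by norm_num) (by norm_num) (by norm_num) x hx h.le
  clear hx
  rename' h => hx
  exact large x hx
end
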